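/- Corollary 1: Assume conditions (A1), (A2), (A3). If τ_n² ⪯ n^{−3/2} q_n and ∫₀^∞ λ⁴ π(λ²) dλ² < ∞, then for any sequence M_n → ∞, E₀ P(‖K_n β_n − K_n β_{0n}‖² ≥ M_n q_n | Y_n) → 0 as n → ∞, where P(·|Y_n) denotes posterior probability. -/

import Mathlib

open MeasureTheory Matrix Filter

noncomputable section

namespace RVM

/-- Squared Euclidean norm of a vector in `ℝⁿ`. -/
def sqnorm {n : ℕ} (v : Fin n → ℝ) : ℝ := v ⬝ᵥ v

/-- The hierarchical Bayesian relevance vector machine model (Model 1) of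
Fang–Ghosh.  For each `n`, `K n` is a symmetric positive definite `n × n` kernel matrix,
`β0 n` is the true coefficient vector, `σ0sq` the true error variance, `τsq n` the global
shrinkage parameter, `pr` the common prior density of the local parameters `λᵢ²` on `(0, ∞)`,
and `a, b` the hyperparameters of the inverse-gamma prior on `σ²`. -/
structure Model where
  K : (n : ℕ) → Matrix (Fin n) (Fin n) ℝ
  β0 : (n : ℕ) → Fin n → ℝ
  σ0sq : ℝ
  τsq : ℕ → ℝ
  pr : ℝ → ℝ
  a : ℝ
  b : ℝ
  hK : ∀ n, (K n).PosDef
  hσ0 : 0 < σ0sq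
  ha : 0 < a
  hb : 0 < b
  hpr_nonneg : ∀ x, 0 ≤ pr x
  hpr_supp : ∀ x ≤ 0, pr x = 0
  hpr_int : ∫ x in Set.Ioi (0 : ℝ), pr x = 1

namespace Model

variable (M : Model)

/-- `q n`: the number of nonzero entries of the true coefficient vector `β0 n`. -/
def q (n : ℕ) : ℕ := {i : Fin n | M.β0 n i ≠ 0}.ncard

/-- The unnormalized joint posterior density of `(β, σ², λ²)` given data `Y`:
`(σ²)^{−n−a/2−1} ∏ᵢ π(λᵢ²) · |Λ²|^{−1/2} ·
  exp[(−b − βᵀ τ⁻² Λ⁻² β − (Y − Kβ)ᵀ(Y − Kβ)) / (2σ²)]`. -/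
def jd (n : ℕ) (Y : Fin n → ℝ) (β : Fin n → ℝ) (s : ℝ) (l : Fin n → ℝ) : ℝ :=
  s ^ (-(n : ℝ) - M.a / 2 - 1) * (∏ i, M.pr (l i)) * (∏ i, l i) ^ (-(1 : ℝ) / 2) *
    Real.exp ((-M.b - (M.τsq n)⁻¹ * ∑ i, (β i) ^ 2 / l i
        - sqnorm (Y - M.K n *ᵥ β)) / (2 * s))

/-- The region `{(β, σ², λ²) : σ² > 0, λᵢ² > 0 ∀ i}` over which the posterior lives. -/
def posSet (n : ℕ) : Set ((Fin n → ℝ) × ℝ × (Fin n → ℝ)) :=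
  {p | 0 < p.2.1 ∧ ∀ i, 0 < p.2.2 i}

/-- Normalizing constant of the posterior given `Y`. -/
def Z (n : ℕ) (Y : Fin n → ℝ) : ℝ :=
  ∫ p in posSet n, M.jd n Y p.1 p.2.1 p.2.2

/-- Posterior mean `E(βₙ | Yₙ)` of the coefficient vector. -/
def postMean (n : ℕ) (Y : Fin n → ℝ) : Fin n → ℝ :=
  (M.Z n Y)⁻¹ • ∫ p in posSet n, M.jd n Y p.1 p.2.1 p.2.2 • p.1

/-- Posterior probability `P(βₙ ∈ E | Yₙ)`. -/
def postProb (n : ℕ) (Y : Fin n → ℝ) (E : Set (Fin n → ℝ)) : ℝ :=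
  (∫ p in posSet n ∩ {p | p.1 ∈ E}, M.jd n Y p.1 p.2.1 p.2.2) / M.Z n Y

/-- Trace of the posterior covariance matrix `V(βₙ | Yₙ)`,
i.e. `E(‖βₙ − E(βₙ|Yₙ)‖² | Yₙ)`. -/
def trPostVar (n : ℕ) (Y : Fin n → ℝ) : ℝ :=
  (M.Z n Y)⁻¹ * ∫ p in posSet n, M.jd n Y p.1 p.2.1 p.2.2 * sqnorm (p.1 - M.postMean n Y)

/-- Trace of the posterior covariance matrix `V(Kₙ βₙ | Yₙ)`,
i.e. `E(‖Kₙβₙ − Kₙ E(βₙ|Yₙ)‖² | Yₙ)`. -/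
def trPostVarK (n : ℕ) (Y : Fin n → ℝ) : ℝ :=
  (M.Z n Y)⁻¹ * ∫ p in posSet n,
    M.jd n Y p.1 p.2.1 p.2.2 * sqnorm (M.K n *ᵥ p.1 - M.K n *ᵥ M.postMean n Y)

/-- Density of the true data-generating distribution `N(Kₙ β₀ₙ, σ₀² Iₙ)`. -/
def trueDens (n : ℕ) (Y : Fin n → ℝ) : ℝ :=
  (2 * Real.pi * M.σ0sq) ^ (-(n : ℝ) / 2) *
    Real.exp (-sqnorm (Y - M.K n *ᵥ M.β0 n) / (2 * M.σ0sq))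

/-- Expectation `E₀` under the true data-generating distribution `Yₙ ~ N(Kₙ β₀ₙ, σ₀² Iₙ)`. -/
def E0 (n : ℕ) (f : (Fin n → ℝ) → ℝ) : ℝ :=
  ∫ Y, f Y * M.trueDens n Y

/-- Condition (A1): `c₁ Iₙ ≤ Kₙ ≤ c₂ Iₙ` for sufficiently large `n`, with constants
`0 < c₁ ≤ c₂` not depending on `n`. -/
def CondA1 : Prop :=
  ∃ c₁ c₂ : ℝ, 0 < c₁ ∧ c₁ ≤ c₂ ∧ ∃ N : ℕ, ∀ n ≥ N,
    (M.K n - c₁ • (1 : Matrix (Fin n) (Fin n) ℝ)).PosSemidef ∧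
      (c₂ • (1 : Matrix (Fin n) (Fin n) ℝ) - M.K n).PosSemidef

/-- Condition (A2): the true coefficients are uniformly bounded, `|β₀ₙ,ᵢ| < M₀` with `M₀`
independent of `n`. -/
def CondA2 : Prop := ∃ M₀ : ℝ, ∀ n, ∀ i : Fin n, |M.β0 n i| < M₀

/-- Condition (A3): `qₙ = o(n)`. -/
def CondA3 : Prop := Tendsto (fun n => (M.q n : ℝ) / n) atTop (nhds 0)

/-- Finite fourth moment of the prior: `∫ λ⁴ π(λ²) dλ² < ∞`. -/
def Moment4 : Prop := IntegrableOn (fun x => x ^ 2 * M.pr x) (Set.Ioi (0 : ℝ))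

/-- Finite inverse second moment of the prior: `∫ λ⁻² π(λ²) dλ² < ∞`. -/
def MomentNeg2 : Prop := IntegrableOn (fun x => x⁻¹ * M.pr x) (Set.Ioi (0 : ℝ))

end Model

end RVM

open RVM Filter

open scoped ENNReal

/-- The Lebesgue integral of a product of one-variable functions factorizes. -/
theorem lintegral_pi_prod {n : ℕ} (f : Fin n → ℝ → ℝ≥0∞) (hf : ∀ i, Measurable (f i)) :
    ∫⁻ x : Fin n → ℝ, ∏ i, f i (x i) = ∏ i, ∫⁻ t, f i t := by
  induction n with
  | zero => simp [lintegral_unique, volume_pi]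
  | succ n ih =>
    have hmp := (volume_preserving_piFinSuccAbove (fun _ : Fin (n + 1) => ℝ) 0).symm
    rw [← hmp.lintegral_comp (f := fun x : Fin (n + 1) → ℝ => ∏ i, f i (x i))
      (Finset.measurable_prod _ fun i _ => (hf i).comp (measurable_pi_apply i)),
      Measure.volume_eq_prod, Fin.prod_univ_succ, ← ih (fun i => f i.succ)
      fun i => hf _, ← lintegral_prod_mul (hf 0).aemeasurable
      (Finset.measurable_prod _ fun i _ =>
        (hf i.succ).comp (measurable_pi_apply i)).aemeasurable]
    refine lintegral_congr fun z => ?_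
    simp [Fin.prod_univ_succ, MeasurableEquiv.piFinSuccAbove]

theorem lintegral_exp_neg_mul_sq {d : ℝ} (hd : 0 < d) :
    ∫⁻ x : ℝ, ENNReal.ofReal (Real.exp (-(d * x ^ 2 / 2)))
      = ENNReal.ofReal (√(2 * Real.pi / d)) := by
  have h := integral_gaussian (d / 2)
  have hi := integrable_exp_neg_mul_sq (half_pos hd)
  have e : ∀ x : ℝ, -(d * x ^ 2 / 2) = -(d / 2) * x ^ 2 := fun x => by ring
  simp_rw [e]
  rw [← ofReal_integral_eq_lintegral_ofReal hi (ae_of_all _ fun x => (Real.exp_pos _).le), h]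
  congr 2
  field_simp

theorem lintegral_exp_neg_diag {n : ℕ} (d : Fin n → ℝ) (hd : ∀ i, 0 < d i) :
    ∫⁻ x : Fin n → ℝ, ENNReal.ofReal (Real.exp (-((∑ i, d i * x i ^ 2) / 2)))
      = ENNReal.ofReal (∏ i, √(2 * Real.pi / d i)) := by
  have e : ∀ x : Fin n → ℝ, ENNReal.ofReal (Real.exp (-((∑ i, d i * x i ^ 2) / 2)))
      = ∏ i, ENNReal.ofReal (Real.exp (-(d i * x i ^ 2 / 2))) := fun x => by
    rw [Finset.sum_div, ← Finset.sum_neg_distrib, Real.exp_sum,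
      ENNReal.ofReal_prod_of_nonneg fun i _ => (Real.exp_pos _).le]
  simp_rw [e]
  rw [lintegral_pi_prod (fun i t => ENNReal.ofReal (Real.exp (-(d i * t ^ 2 / 2))))
    fun i => by fun_prop, ENNReal.ofReal_prod_of_nonneg fun i _ => Real.sqrt_nonneg _]
  exact Finset.prod_congr rfl fun i _ => lintegral_exp_neg_mul_sq (hd i)

theorem sqnorm_eq_sum {n : ℕ} (v : Fin n → ℝ) : sqnorm v = ∑ i, v i ^ 2 := by
  simp [sqnorm, dotProduct, sq]

theorem sqnorm_nonneg {n : ℕ} (v : Fin n → ℝ) : 0 ≤ sqnorm v := by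
  rw [sqnorm_eq_sum]; positivity

theorem continuous_sqnorm {n : ℕ} : Continuous (sqnorm : (Fin n → ℝ) → ℝ) := by
  unfold sqnorm dotProduct; fun_prop

theorem sqnorm_add {n : ℕ} (u v : Fin n → ℝ) :
    sqnorm (u + v) = sqnorm u + 2 * (u ⬝ᵥ v) + sqnorm v := by
  simp only [sqnorm, add_dotProduct, dotProduct_add, dotProduct_comm v u]; ring

theorem sqnorm_sub {n : ℕ} (u v : Fin n → ℝ) :
    sqnorm (u - v) = sqnorm u - 2 * (u ⬝ᵥ v) + sqnorm v := by
  simp only [sqnorm, sub_dotProduct, dotProduct_sub, dotProduct_comm v u]; ring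

theorem sqnorm_smul {n : ℕ} (c : ℝ) (v : Fin n → ℝ) : sqnorm (c • v) = c ^ 2 * sqnorm v := by
  simp only [sqnorm, smul_dotProduct, dotProduct_smul, smul_eq_mul]; ring

theorem sqnorm_add_le {n : ℕ} (u v : Fin n → ℝ) :
    sqnorm (u + v) ≤ 2 * sqnorm u + 2 * sqnorm v := by
  have := sqnorm_nonneg (u - v)
  rw [sqnorm_sub] at this
  rw [sqnorm_add]; linarith

theorem dotProduct_le_sqnorm {n : ℕ} (u v : Fin n → ℝ) :
    u ⬝ᵥ v ≤ sqnorm u + sqnorm v / 4 := by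
  have := sqnorm_nonneg (u - (1 / 2 : ℝ) • v)
  rw [sqnorm_sub, sqnorm_smul, dotProduct_smul, smul_eq_mul] at this
  linarith

theorem lintegral_gaussian_sqnorm {n : ℕ} {s : ℝ} (hs : 0 < s) (m : Fin n → ℝ) :
    ∫⁻ y : Fin n → ℝ, ENNReal.ofReal (Real.exp (-(sqnorm (y - m) / (2 * s))))
      = ENNReal.ofReal (√(2 * Real.pi * s) ^ n) := by
  rw [lintegral_sub_right_eq_self
    (fun y : Fin n → ℝ => ENNReal.ofReal (Real.exp (-(sqnorm y / (2 * s))))) m]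
  have h := lintegral_exp_neg_diag (n := n) (fun _ => 1 / s) fun _ => by positivity
  rw [Finset.prod_const, Finset.card_univ, Fintype.card_fin] at h
  have e : ∀ y : Fin n → ℝ, sqnorm y / (2 * s) = (∑ i, 1 / s * y i ^ 2) / 2 := fun y => by
    rw [sqnorm_eq_sum, ← Finset.mul_sum]
    field_simp
  simp_rw [e, h]
  rw [div_div_eq_mul_div, div_one]

/-- Moment generating function of the centred Gaussian vector with variance `s`. -/
theorem lintegral_gaussian_mgf {n : ℕ} {s : ℝ} (hs : 0 < s) (m t : Fin n → ℝ) :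
    ∫⁻ y : Fin n → ℝ, ENNReal.ofReal
        (Real.exp (t ⬝ᵥ (y - m)) * Real.exp (-(sqnorm (y - m) / (2 * s))))
      = ENNReal.ofReal (Real.exp (s * sqnorm t / 2) * √(2 * Real.pi * s) ^ n) := by
  rw [ENNReal.ofReal_mul (Real.exp_pos _).le, ← lintegral_gaussian_sqnorm hs (m + s • t),
    ← lintegral_const_mul _ (by have := @continuous_sqnorm n; fun_prop)]
  refine lintegral_congr fun y => ?_
  rw [← ENNReal.ofReal_mul (Real.exp_pos _).le, ← Real.exp_add, ← Real.exp_add]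
  congr 2
  rw [← sub_sub, sqnorm_sub (y - m), sqnorm_smul, dotProduct_smul, smul_eq_mul,
    dotProduct_comm t]
  field_simp
  ring

theorem dotProduct_mulVec_comm {n : ℕ} {A : Matrix (Fin n) (Fin n) ℝ} (hA : A.IsHermitian)
    (u v : Fin n → ℝ) : u ⬝ᵥ A *ᵥ v = (A *ᵥ u) ⬝ᵥ v := by
  have h : Aᵀ = A := by simpa [conjTranspose_eq_transpose_of_trivial] using hA.eq
  rw [dotProduct_mulVec, ← mulVec_transpose, h]

theorem le_sqnorm_mulVec {n : ℕ} {A : Matrix (Fin n) (Fin n) ℝ} {c : ℝ} (hc : 0 < c)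
    (h : (A - c • (1 : Matrix (Fin n) (Fin n) ℝ)).PosSemidef) (v : Fin n → ℝ) :
    c ^ 2 * sqnorm v ≤ sqnorm (A *ᵥ v) := by
  have h1 := h.dotProduct_mulVec_nonneg v
  have h2 := sqnorm_nonneg (A *ᵥ v - c • v)
  rw [sqnorm_sub, sqnorm_smul, dotProduct_smul, smul_eq_mul, dotProduct_comm] at h2
  simp only [star_trivial, sub_mulVec, smul_mulVec, one_mulVec, dotProduct_sub,
    dotProduct_smul, smul_eq_mul] at h1
  change 0 ≤ _ - c * sqnorm v at h1
  nlinarith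

theorem sqnorm_mulVec_le {n : ℕ} {A : Matrix (Fin n) (Fin n) ℝ} (hA : A.PosSemidef) {c : ℝ}
    (hc : 0 < c) (h : (c • (1 : Matrix (Fin n) (Fin n) ℝ) - A).PosSemidef) (v : Fin n → ℝ) :
    sqnorm (A *ᵥ v) ≤ c ^ 2 * sqnorm v := by
  have h1 := h.dotProduct_mulVec_nonneg v
  have h2 := h.dotProduct_mulVec_nonneg (A *ᵥ v)
  have h3 := hA.dotProduct_mulVec_nonneg (A *ᵥ v - c • v)
  simp only [star_trivial, sub_mulVec, smul_mulVec, one_mulVec, dotProduct_sub, mulVec_sub,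
    dotProduct_smul, smul_eq_mul, sub_dotProduct, smul_dotProduct, mulVec_smul] at h1 h2 h3
  rw [dotProduct_mulVec_comm hA.isHermitian v (A *ᵥ v)] at h3
  change 0 ≤ c * sqnorm v - _ at h1
  change 0 ≤ c * sqnorm (A *ᵥ v) - _ at h2
  change 0 ≤ _ - c * sqnorm (A *ᵥ v) - c * (sqnorm (A *ᵥ v) - _) at h3
  have h4 : c * sqnorm (A *ᵥ v) ≤ c * (c ^ 2 * sqnorm v) := by nlinarith [sq_nonneg c]
  exact le_of_mul_le_mul_left h4 hc

theorem exists_mulVec_eq {n : ℕ} {P : Matrix (Fin n) (Fin n) ℝ} {d : Fin n → ℝ}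
    (hd : ∀ i, 0 < d i) (hPd : ∀ u, ∑ i, d i * u i ^ 2 ≤ u ⬝ᵥ P *ᵥ u) (g : Fin n → ℝ) :
    ∃ w, P *ᵥ w = g := by
  have hinj : Function.Injective P.mulVecLin := by
    rw [← LinearMap.ker_eq_bot, LinearMap.ker_eq_bot']
    intro u hu
    have h0 : P *ᵥ u = 0 := hu
    have h := hPd u
    rw [h0, dotProduct_zero] at h
    have h' := (Finset.sum_eq_zero_iff_of_nonneg fun i _ =>
      mul_nonneg (hd i).le (sq_nonneg (u i))).1
        (le_antisymm h (Finset.sum_nonneg fun i _ => mul_nonneg (hd i).le (sq_nonneg (u i))))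
    ext i
    simpa [(hd i).ne'] using h' i (Finset.mem_univ i)
  exact LinearMap.injective_iff_surjective.1 hinj g

theorem dotProduct_solution_le {n : ℕ} {P : Matrix (Fin n) (Fin n) ℝ} {d : Fin n → ℝ}
    (hd : ∀ i, 0 < d i) (hPd : ∀ u, ∑ i, d i * u i ^ 2 ≤ u ⬝ᵥ P *ᵥ u) {w g : Fin n → ℝ}
    (h : P *ᵥ w = g) : w ⬝ᵥ g ≤ ∑ i, g i ^ 2 / d i := by
  have h1 := hPd w
  rw [h] at h1
  have h2 : w ⬝ᵥ g ≤ ∑ i, (g i ^ 2 / d i + d i * w i ^ 2) / 2 := by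
    refine Finset.sum_le_sum fun i _ => ?_
    have h3 := sq_nonneg (g i - d i * w i)
    have h4 : (w i * g i) * d i ≤ ((g i ^ 2 / d i + d i * w i ^ 2) / 2) * d i := by
      have : g i ^ 2 / d i * d i = g i ^ 2 := div_mul_cancel₀ _ (hd i).ne'
      nlinarith
    exact le_of_mul_le_mul_right h4 (hd i)
  rw [← Finset.sum_div, Finset.sum_add_distrib] at h2
  linarith

/-- Coordinatewise second moment of an unnormalized Gaussian density. -/
theorem lintegral_coord_sq_gaussian_le {n : ℕ} {P : Matrix (Fin n) (Fin n) ℝ}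
    (hP : P.IsHermitian) {d : Fin n → ℝ} (hd : ∀ i, 0 < d i)
    (hPd : ∀ u, ∑ i, d i * u i ^ 2 ≤ u ⬝ᵥ P *ᵥ u) {s : ℝ} (hs : 0 < s) (i : Fin n) :
    ∫⁻ u : Fin n → ℝ, ENNReal.ofReal (u i ^ 2 * Real.exp (-(u ⬝ᵥ P *ᵥ u / (2 * s))))
      ≤ ENNReal.ofReal (8 * s / d i) *
        ∫⁻ u : Fin n → ℝ, ENNReal.ofReal (Real.exp (-(u ⬝ᵥ P *ᵥ u / (2 * s)))) := by
  obtain ⟨w, hw⟩ := exists_mulVec_eq hd hPd (Pi.single i 1)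
  have hwi : w i ≤ 1 / d i := by
    have h := dotProduct_solution_le hd hPd hw
    rw [dotProduct_single, mul_one, Finset.sum_eq_single i] at h
    · simpa using h
    · intro j _ hj
      simp [hj]
    · simp
  set F : (Fin n → ℝ) → ℝ := fun u => Real.exp (-(u ⬝ᵥ P *ᵥ u / (2 * s))) with hF
  have hFm : Measurable F := by
    have : Continuous F := by
      simp only [hF, dotProduct, mulVec]; fun_prop
    exact this.measurable
  have hshift : ∀ r : ℝ, r ^ 2 = d i / s →
      ∫⁻ u, ENNReal.ofReal (Real.exp (r * u i) * F u)
        ≤ ENNReal.ofReal (Real.exp (1 / 2)) * ∫⁻ u, ENNReal.ofReal (F u) := by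
    intro r hr
    rw [← lintegral_sub_right_eq_self (fun u => ENNReal.ofReal (F u)) ((s * r) • w),
      ← lintegral_const_mul _ (by fun_prop)]
    refine lintegral_mono fun u => ?_
    rw [← ENNReal.ofReal_mul (Real.exp_pos _).le]
    refine ENNReal.ofReal_le_ofReal ?_
    simp only [hF, ← Real.exp_add]
    refine Real.exp_le_exp.2 ?_
    have e : (u - (s * r) • w) ⬝ᵥ P *ᵥ (u - (s * r) • w)
        = u ⬝ᵥ P *ᵥ u - 2 * (s * r) * u i + (s * r) ^ 2 * w i := by
      have e1 : w ⬝ᵥ P *ᵥ u = u i := by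
        rw [dotProduct_mulVec_comm hP, hw, single_dotProduct, one_mul]
      simp only [mulVec_sub, mulVec_smul, hw, dotProduct_sub, sub_dotProduct, smul_dotProduct,
        dotProduct_smul, smul_eq_mul, e1, dotProduct_single, mul_one, Pi.sub_apply, Pi.smul_apply]
      ring
    rw [e]
    have e2 : (s * r) ^ 2 * w i ≤ s := by
      rw [mul_pow, hr]
      calc s ^ 2 * (d i / s) * w i = s * d i * w i := by field_simp
        _ ≤ s * d i * (1 / d i) := by
          gcongr
          exact (mul_pos hs (hd i)).le
        _ = s := by have := (hd i).ne'; field_simp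
    have e3 : (s * r) ^ 2 * w i / (2 * s) ≤ 1 / 2 := by
      rw [div_le_div_iff₀ (by positivity) two_pos]; linarith
    have e4 : (u ⬝ᵥ P *ᵥ u - 2 * (s * r) * u i + (s * r) ^ 2 * w i) / (2 * s)
        = u ⬝ᵥ P *ᵥ u / (2 * s) - r * u i + (s * r) ^ 2 * w i / (2 * s) := by
      field_simp
    rw [e4]
    linarith
  set r := √(d i / s) with hr
  have hr2 : r ^ 2 = d i / s := Real.sq_sqrt (div_pos (hd i) hs).le
  have hcosh : ∀ y : ℝ, y ^ 2 ≤ 2 * (Real.exp y + Real.exp (-y)) := by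
    have h0 : ∀ y : ℝ, 0 ≤ y → y ^ 2 ≤ 2 * (Real.exp y + Real.exp (-y)) := fun y hy => by
      have h1 := Real.quadratic_le_exp_of_nonneg hy
      have h2 := Real.add_one_le_exp (-y)
      linarith
    intro y
    rcases le_total 0 y with hy | hy
    · exact h0 y hy
    · have := h0 (-y) (by linarith)
      rw [neg_neg, neg_sq] at this
      linarith
  have hsum : ENNReal.ofReal (d i / s) * ∫⁻ u, ENNReal.ofReal (u i ^ 2 * F u)
      ≤ ENNReal.ofReal 8 * ∫⁻ u, ENNReal.ofReal (F u) := by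
    have hm : Measurable fun u : Fin n → ℝ => ENNReal.ofReal (u i ^ 2 * F u) := by fun_prop
    rw [← lintegral_const_mul _ hm]
    calc ∫⁻ u, ENNReal.ofReal (d i / s) * ENNReal.ofReal (u i ^ 2 * F u)
        ≤ ∫⁻ u, (ENNReal.ofReal (2 * Real.exp (r * u i) * F u)
          + ENNReal.ofReal (2 * Real.exp (-r * u i) * F u)) := by
          refine lintegral_mono fun u => ?_
          have hFp : 0 < F u := Real.exp_pos _
          rw [← ENNReal.ofReal_mul (div_pos (hd i) hs).le,
            ← ENNReal.ofReal_add (by positivity) (by positivity)]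
          refine ENNReal.ofReal_le_ofReal ?_
          have := hcosh (r * u i)
          rw [mul_pow, hr2] at this
          rw [neg_mul, ← add_mul, ← mul_assoc]
          refine mul_le_mul_of_nonneg_right ?_ hFp.le
          linarith
      _ = ENNReal.ofReal 2 * (∫⁻ u, ENNReal.ofReal (Real.exp (r * u i) * F u))
          + ENNReal.ofReal 2 * (∫⁻ u, ENNReal.ofReal (Real.exp (-r * u i) * F u)) := by
          rw [lintegral_add_left (by fun_prop), ← lintegral_const_mul _ (by fun_prop),
            ← lintegral_const_mul _ (by fun_prop)]
          simp_rw [← ENNReal.ofReal_mul zero_le_two, mul_assoc]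
      _ ≤ ENNReal.ofReal 2 * (ENNReal.ofReal (Real.exp (1 / 2)) * ∫⁻ u, ENNReal.ofReal (F u))
          + ENNReal.ofReal 2 *
            (ENNReal.ofReal (Real.exp (1 / 2)) * ∫⁻ u, ENNReal.ofReal (F u)) := by
          gcongr
          · exact hshift r hr2
          · exact hshift (-r) (by rw [neg_sq, hr2])
      _ ≤ _ := by
          rw [← mul_assoc, ← add_mul, ← ENNReal.ofReal_mul zero_le_two,
            ← ENNReal.ofReal_add (by positivity) (by positivity)]
          gcongr
          have h1 : Real.exp (1 / 2) ^ 2 = Real.exp 1 := by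
            rw [← Real.exp_nat_mul]; norm_num
          have h2 := Real.exp_one_lt_d9
          nlinarith [Real.exp_pos (1 / 2)]
  calc ∫⁻ u, ENNReal.ofReal (u i ^ 2 * F u)
      = ENNReal.ofReal (s / d i) *
        (ENNReal.ofReal (d i / s) * ∫⁻ u, ENNReal.ofReal (u i ^ 2 * F u)) := by
        rw [← mul_assoc, ← ENNReal.ofReal_mul (div_pos hs (hd i)).le, div_mul_div_cancel₀
          (hd i).ne', div_self hs.ne', ENNReal.ofReal_one, one_mul]
    _ ≤ ENNReal.ofReal (s / d i) * (ENNReal.ofReal 8 * ∫⁻ u, ENNReal.ofReal (F u)) := by gcongr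
    _ = _ := by
        rw [← mul_assoc, ← ENNReal.ofReal_mul (div_pos hs (hd i)).le]
        congr 2
        ring

/-- Conditional second moment of the fitted values given the scale parameters. -/
theorem lintegral_sqnorm_fit_le {n : ℕ} {A : Matrix (Fin n) (Fin n) ℝ} (hA : A.IsHermitian)
    {c₁ c₂ : ℝ} (hc₁ : 0 < c₁) (hlow : ∀ v, c₁ ^ 2 * sqnorm v ≤ sqnorm (A *ᵥ v))
    (hup : ∀ v, sqnorm (A *ᵥ v) ≤ c₂ ^ 2 * sqnorm v) {e : Fin n → ℝ} (he : ∀ i, 0 < e i)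
    (Y β₀ : Fin n → ℝ) {L : ℝ} (hz : ∀ i, (A *ᵥ (Y - A *ᵥ β₀)) i ^ 2 ≤ L) {s : ℝ} (hs : 0 < s) :
    ∫⁻ β : Fin n → ℝ, ENNReal.ofReal (sqnorm (A *ᵥ β) *
        Real.exp (-((sqnorm (Y - A *ᵥ β) + ∑ i, e i * β i ^ 2) / (2 * s))))
      ≤ ENNReal.ofReal (4 * sqnorm (A *ᵥ β₀) + 4 * (L * ∑ i, 1 / (c₁ ^ 2 + e i))
          + 16 * (c₂ ^ 2 * s * ∑ i, 1 / (c₁ ^ 2 + e i))) *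
        ∫⁻ β : Fin n → ℝ, ENNReal.ofReal
          (Real.exp (-((sqnorm (Y - A *ᵥ β) + ∑ i, e i * β i ^ 2) / (2 * s)))) := by
  set d : Fin n → ℝ := fun i => c₁ ^ 2 + e i with hdd
  have hd : ∀ i, 0 < d i := fun i => by have := he i; positivity
  set P : Matrix (Fin n) (Fin n) ℝ := A * A + diagonal e with hPdef
  have hPmul : ∀ u, P *ᵥ u = A *ᵥ (A *ᵥ u) + fun i => e i * u i := fun u => by
    rw [hPdef, add_mulVec, mulVec_mulVec]
    congr 1
    ext i
    rw [mulVec_diagonal]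
  have hdot : ∀ u v, u ⬝ᵥ P *ᵥ v = (A *ᵥ u) ⬝ᵥ (A *ᵥ v) + ∑ i, e i * (u i * v i) := fun u v => by
    rw [hPmul, dotProduct_add, dotProduct_mulVec_comm hA]
    congr 1
    exact Finset.sum_congr rfl fun i _ => by ring
  have hquad : ∀ u, u ⬝ᵥ P *ᵥ u = sqnorm (A *ᵥ u) + ∑ i, e i * u i ^ 2 := fun u => by
    rw [hdot]
    simp only [sqnorm, sq]
  have hP : P.IsHermitian := by
    refine IsHermitian.add ?_ (isHermitian_diagonal e)
    rw [IsHermitian, conjTranspose_mul, hA.eq]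
  have hPd : ∀ u, ∑ i, d i * u i ^ 2 ≤ u ⬝ᵥ P *ᵥ u := fun u => by
    rw [hquad]
    simp only [hdd, add_mul, Finset.sum_add_distrib, ← Finset.mul_sum]
    have := hlow u
    rw [sqnorm_eq_sum u] at this
    linarith
  obtain ⟨b, hb⟩ := exists_mulVec_eq hd hPd (A *ᵥ Y)
  have hL : 0 ≤ L * ∑ i, 1 / d i := by
    rcases isEmpty_or_nonempty (Fin n) with h | ⟨⟨i⟩⟩
    · simp
    · exact mul_nonneg ((sq_nonneg _).trans (hz i))
        (Finset.sum_nonneg fun i _ => (one_div_pos.2 (hd i)).le)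
  have hbb : sqnorm (A *ᵥ b) ≤ 2 * sqnorm (A *ᵥ β₀) + 2 * (L * ∑ i, 1 / d i) := by
    have h1 : b ⬝ᵥ P *ᵥ b
        = (A *ᵥ β₀) ⬝ᵥ (A *ᵥ b) + (A *ᵥ (Y - A *ᵥ β₀)) ⬝ᵥ b := by
      rw [hb, mulVec_sub, sub_dotProduct, dotProduct_comm b,
        ← dotProduct_mulVec_comm hA (A *ᵥ β₀) b]
      ring
    have h2 := dotProduct_le_sqnorm (A *ᵥ β₀) (A *ᵥ b)
    have h3 : (A *ᵥ (Y - A *ᵥ β₀)) ⬝ᵥ b ≤ ∑ i, (L * (1 / d i) + d i * b i ^ 2 / 4) := by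
      refine Finset.sum_le_sum fun i _ => ?_
      have h4 := sq_nonneg ((A *ᵥ (Y - A *ᵥ β₀)) i - d i * b i / 2)
      have h5 := hz i
      have h6 : L * (1 / d i) * d i = L := by
        rw [mul_assoc, one_div_mul_cancel (hd i).ne', mul_one]
      refine le_of_mul_le_mul_right ?_ (hd i)
      rw [add_mul, h6]
      nlinarith
    rw [Finset.sum_add_distrib, ← Finset.mul_sum, ← Finset.sum_div] at h3
    have h7 := hPd b
    have h8 := hquad b
    have h9 : 0 ≤ ∑ i, e i * b i ^ 2 :=
      Finset.sum_nonneg fun i _ => mul_nonneg (he i).le (sq_nonneg _)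
    linarith
  have hcentre : ∀ u, sqnorm (Y - A *ᵥ (u + b)) + ∑ i, e i * (u + b) i ^ 2
      = (sqnorm (Y - A *ᵥ b) + ∑ i, e i * b i ^ 2) + u ⬝ᵥ P *ᵥ u := fun u => by
    have h1 : u ⬝ᵥ P *ᵥ b = (A *ᵥ u) ⬝ᵥ Y := by rw [hb, dotProduct_mulVec_comm hA]
    rw [hdot] at h1
    have h2 : ∑ i, e i * (u + b) i ^ 2
        = ∑ i, e i * u i ^ 2 + 2 * ∑ i, e i * (u i * b i) + ∑ i, e i * b i ^ 2 := by
      rw [Finset.mul_sum, ← Finset.sum_add_distrib, ← Finset.sum_add_distrib]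
      exact Finset.sum_congr rfl fun i _ => by rw [Pi.add_apply]; ring
    have h3 : Y - A *ᵥ (u + b) = (Y - A *ᵥ b) - A *ᵥ u := by rw [mulVec_add]; abel
    rw [h2, h3, sqnorm_sub, hquad, sub_dotProduct, dotProduct_comm Y, dotProduct_comm (A *ᵥ b)]
    linarith
  set E₀ := Real.exp (-((sqnorm (Y - A *ᵥ b) + ∑ i, e i * b i ^ 2) / (2 * s))) with hE₀
  have hE₀p : 0 ≤ E₀ := (Real.exp_pos _).le
  set F : (Fin n → ℝ) → ℝ := fun u => Real.exp (-(u ⬝ᵥ P *ᵥ u / (2 * s))) with hF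
  have hFp : ∀ u, 0 < F u := fun u => Real.exp_pos _
  have hFm : Measurable F := by
    have : Continuous F := by
      simp only [hF, dotProduct, mulVec]; fun_prop
    exact this.measurable
  have hexp : ∀ u, Real.exp (-((sqnorm (Y - A *ᵥ (u + b)) + ∑ i, e i * (u + b) i ^ 2) / (2 * s)))
      = E₀ * F u := fun u => by
    rw [hE₀, hF, ← Real.exp_add, hcentre]
    congr 1
    ring
  rw [← lintegral_add_right_eq_self (fun β => ENNReal.ofReal (sqnorm (A *ᵥ β) *
        Real.exp (-((sqnorm (Y - A *ᵥ β) + ∑ i, e i * β i ^ 2) / (2 * s))))) b,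
    ← lintegral_add_right_eq_self (fun β => ENNReal.ofReal (
        Real.exp (-((sqnorm (Y - A *ᵥ β) + ∑ i, e i * β i ^ 2) / (2 * s))))) b]
  simp_rw [hexp]
  have hIm : Measurable fun u => ENNReal.ofReal (F u) := by fun_prop
  set I := ∫⁻ u, ENNReal.ofReal (F u) with hI
  have hcoord := fun i => lintegral_coord_sq_gaussian_le hP hd hPd hs i
  have hX : 0 ≤ ∑ i, 1 / d i := Finset.sum_nonneg fun i _ => (one_div_pos.2 (hd i)).le
  have hsum : ∫⁻ u : Fin n → ℝ, ENNReal.ofReal (sqnorm u * F u)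
      ≤ ENNReal.ofReal (8 * s * ∑ i, 1 / d i) * I := by
    calc ∫⁻ u : Fin n → ℝ, ENNReal.ofReal (sqnorm u * F u)
        = ∫⁻ u : Fin n → ℝ, ∑ i, ENNReal.ofReal (u i ^ 2 * F u) := by
          refine lintegral_congr fun u => ?_
          rw [sqnorm_eq_sum, Finset.sum_mul, ENNReal.ofReal_sum_of_nonneg]
          exact fun i _ => mul_nonneg (sq_nonneg _) (hFp u).le
      _ = ∑ i, ∫⁻ u : Fin n → ℝ, ENNReal.ofReal (u i ^ 2 * F u) :=
          lintegral_finsetSum _ fun i _ => by fun_prop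
      _ ≤ ∑ i, ENNReal.ofReal (8 * s / d i) * I := Finset.sum_le_sum fun i _ => hcoord i
      _ = _ := by
          rw [← Finset.sum_mul, ← ENNReal.ofReal_sum_of_nonneg
            fun i _ => div_nonneg (by positivity) (hd i).le, Finset.mul_sum]
          simp_rw [mul_one_div]
  have hnorm : Measurable fun u : Fin n → ℝ => sqnorm u := continuous_sqnorm.measurable
  have hbn := sqnorm_nonneg (A *ᵥ b)
  calc ∫⁻ u, ENNReal.ofReal (sqnorm (A *ᵥ (u + b)) * (E₀ * F u))
      ≤ ∫⁻ u, (ENNReal.ofReal (E₀ * (2 * c₂ ^ 2)) * ENNReal.ofReal (sqnorm u * F u)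
          + ENNReal.ofReal (E₀ * (2 * sqnorm (A *ᵥ b))) * ENNReal.ofReal (F u)) := by
        refine lintegral_mono fun u => ?_
        have hu := sqnorm_nonneg u
        have hFu := (hFp u).le
        rw [← ENNReal.ofReal_mul (by positivity), ← ENNReal.ofReal_mul (by positivity),
          ← ENNReal.ofReal_add (by positivity) (by positivity)]
        refine ENNReal.ofReal_le_ofReal ?_
        have h1 := sqnorm_add_le (A *ᵥ u) (A *ᵥ b)
        rw [← mulVec_add] at h1
        have h2 := hup u
        calc sqnorm (A *ᵥ (u + b)) * (E₀ * F u)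
            ≤ (2 * (c₂ ^ 2 * sqnorm u) + 2 * sqnorm (A *ᵥ b)) * (E₀ * F u) := by
              gcongr
              linarith
          _ = _ := by ring
    _ = ENNReal.ofReal (E₀ * (2 * c₂ ^ 2)) * (∫⁻ u, ENNReal.ofReal (sqnorm u * F u))
          + ENNReal.ofReal (E₀ * (2 * sqnorm (A *ᵥ b))) * I := by
        rw [lintegral_add_left (by fun_prop), lintegral_const_mul _ (by fun_prop),
          lintegral_const_mul _ hIm]
    _ ≤ ENNReal.ofReal (E₀ * (2 * c₂ ^ 2)) * (ENNReal.ofReal (8 * s * ∑ i, 1 / d i) * I)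
          + ENNReal.ofReal (E₀ * (2 * sqnorm (A *ᵥ b))) * I := by gcongr
    _ = ENNReal.ofReal (E₀ * (2 * c₂ ^ 2) * (8 * s * ∑ i, 1 / d i)
          + E₀ * (2 * sqnorm (A *ᵥ b))) * I := by
        rw [← mul_assoc, ← ENNReal.ofReal_mul (by positivity), ← add_mul,
          ← ENNReal.ofReal_add (by positivity) (by positivity)]
    _ ≤ ENNReal.ofReal ((4 * sqnorm (A *ᵥ β₀) + 4 * (L * ∑ i, 1 / d i)
          + 16 * (c₂ ^ 2 * s * ∑ i, 1 / d i)) * E₀) * I := by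
        gcongr
        nlinarith
    _ = _ := by
        simp_rw [ENNReal.ofReal_mul hE₀p]
        have h₀ := sqnorm_nonneg (A *ᵥ β₀)
        have h₁ : 0 ≤ c₂ ^ 2 * s * ∑ i, 1 / d i := by positivity
        have h₂ : 0 ≤ 4 * sqnorm (A *ᵥ β₀) + 4 * (L * ∑ i, 1 / d i)
          + 16 * (c₂ ^ 2 * s * ∑ i, 1 / d i) := by linarith
        rw [lintegral_const_mul _ hIm, ENNReal.ofReal_mul h₂, mul_assoc]

/-- Lower bound for the marginal likelihood by symmetrization. -/
theorem le_lintegral_symmetrized {n : ℕ} {A : Matrix (Fin n) (Fin n) ℝ}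
    {c₂ : ℝ} (hup : ∀ v, sqnorm (A *ᵥ v) ≤ c₂ ^ 2 * sqnorm v) {e : Fin n → ℝ}
    (he : ∀ i, 0 < e i) (Y : Fin n → ℝ) {s : ℝ} (hs : 0 < s) :
    ENNReal.ofReal (Real.exp (-(sqnorm Y / (2 * s))) * ∏ i, √(2 * Real.pi * s / (c₂ ^ 2 + e i)))
      ≤ ∫⁻ β : Fin n → ℝ, ENNReal.ofReal
          (Real.exp (-((sqnorm (Y - A *ᵥ β) + ∑ i, e i * β i ^ 2) / (2 * s)))) := by
  set F : (Fin n → ℝ) → ℝ := fun β =>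
    Real.exp (-((sqnorm (Y - A *ᵥ β) + ∑ i, e i * β i ^ 2) / (2 * s))) with hF
  have hFm : Measurable F := by
    have : Continuous F := by
      have := @continuous_sqnorm n
      simp only [hF]; fun_prop
    exact this.measurable
  set G : (Fin n → ℝ) → ℝ := fun β =>
    Real.exp (-(sqnorm Y / (2 * s))) *
      Real.exp (-((∑ i, (c₂ ^ 2 + e i) / s * β i ^ 2) / 2)) with hG
  have hGI : ∫⁻ β, ENNReal.ofReal (G β)
      = ENNReal.ofReal (Real.exp (-(sqnorm Y / (2 * s))) *
        ∏ i, √(2 * Real.pi * s / (c₂ ^ 2 + e i))) := by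
    simp_rw [hG, ENNReal.ofReal_mul (Real.exp_pos _).le]
    rw [lintegral_const_mul _ (by fun_prop), lintegral_exp_neg_diag _
      fun i => div_pos (by have := he i; positivity) hs]
    simp_rw [div_div_eq_mul_div]
  have hpt : ∀ β, ENNReal.ofReal (G β) + ENNReal.ofReal (G β)
      ≤ ENNReal.ofReal (F β) + ENNReal.ofReal (F (-β)) := fun β => by
    rw [← ENNReal.ofReal_add (by positivity) (by positivity),
      ← ENNReal.ofReal_add (by positivity) (by positivity)]
    refine ENNReal.ofReal_le_ofReal ?_
    have hcosh : ∀ x y : ℝ, Real.exp x + Real.exp x ≤ Real.exp (x + y) + Real.exp (x - y) := by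
      intro x y
      rw [Real.exp_add, sub_eq_add_neg, Real.exp_add]
      have h1 : 2 ≤ Real.exp y + Real.exp (-y) := by
        linarith [Real.add_one_le_exp y, Real.add_one_le_exp (-y)]
      nlinarith [Real.exp_pos x]
    have hGle : G β ≤ Real.exp
        (-((sqnorm Y + sqnorm (A *ᵥ β) + ∑ i, e i * β i ^ 2) / (2 * s))) := by
      simp only [hG]
      rw [← Real.exp_add]
      refine Real.exp_le_exp.2 ?_
      have h1 := hup β
      have h2 : (∑ i, (c₂ ^ 2 + e i) / s * β i ^ 2) / 2
          = (c₂ ^ 2 * sqnorm β + ∑ i, e i * β i ^ 2) / (2 * s) := by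
        rw [sqnorm_eq_sum, Finset.mul_sum, ← Finset.sum_add_distrib, Finset.sum_div,
          Finset.sum_div]
        exact Finset.sum_congr rfl fun i _ => by field_simp
      rw [h2, ← neg_add, neg_le_neg_iff, ← add_div]
      exact div_le_div_of_nonneg_right (by linarith) (by positivity)
    refine (add_le_add hGle hGle).trans ((hcosh _ (2 * (Y ⬝ᵥ A *ᵥ β) / (2 * s))).trans_eq ?_)
    simp only [hF, mulVec_neg, sub_neg_eq_add]
    simp only [sqnorm_add, sqnorm_sub, Pi.neg_apply, neg_sq]
    congr 2 <;> ring
  have hneg : ∫⁻ β, ENNReal.ofReal (F (-β)) = ∫⁻ β, ENNReal.ofReal (F β) :=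
    lintegral_neg_eq_self (fun β => ENNReal.ofReal (F β))
  have h2 : 2 * ∫⁻ β, ENNReal.ofReal (G β) ≤ 2 * ∫⁻ β, ENNReal.ofReal (F β) := by
    rw [two_mul, two_mul]
    nth_rewrite 2 [← hneg]
    rw [← lintegral_add_left (by fun_prop), ← lintegral_add_left (by fun_prop)]
    exact lintegral_mono hpt
  rw [← hGI]
  exact (ENNReal.mul_le_mul_iff_right two_ne_zero ENNReal.ofNat_ne_top).1 h2

/-- Unnormalized inverse-gamma density. -/
def igKernel (a b s : ℝ) : ℝ := s ^ (-a / 2 - 1) * Real.exp (-b / (2 * s))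

theorem igKernel_nonneg {a b s : ℝ} (hs : 0 ≤ s) : 0 ≤ igKernel a b s := by
  unfold igKernel; positivity

theorem measurable_igKernel (a b : ℝ) : Measurable (igKernel a b) := by
  unfold igKernel; fun_prop

/-- The inverse-gamma kernel has finite mass. -/
theorem lintegral_igKernel_lt_top {a b : ℝ} (ha : 0 < a) (hb : 0 < b) :
    ∫⁻ s in Set.Ioi (0 : ℝ), ENNReal.ofReal (igKernel a b s) < ∞ := by
  rw [← Set.Ioc_union_Ioi_eq_Ioi (zero_le_one' ℝ)]
  refine (lintegral_union_le _ _ _).trans_lt (ENNReal.add_lt_top.2 ⟨?_, ?_⟩)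
  · set N := ⌈a / 2 + 1⌉₊
    have hN : a / 2 + 1 ≤ N := Nat.le_ceil _
    have hle : ∀ s ∈ Set.Ioc (0 : ℝ) 1,
        ENNReal.ofReal (igKernel a b s) ≤ ENNReal.ofReal ((2 / b) ^ N * N.factorial) := by
      rintro s ⟨hs0, hs1⟩
      refine ENNReal.ofReal_le_ofReal ?_
      have h1 : s ^ (-a / 2 - 1) ≤ (2 / b) ^ N * (b / (2 * s)) ^ N := by
        calc s ^ (-a / 2 - 1) ≤ s ^ (-(N : ℝ)) :=
              Real.rpow_le_rpow_of_exponent_ge hs0 hs1 (by linarith)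
          _ = (2 / b) ^ N * (b / (2 * s)) ^ N := by
              rw [Real.rpow_neg hs0.le, Real.rpow_natCast, ← mul_pow, ← inv_pow]
              congr 1
              field_simp
      have h2 := Real.pow_div_factorial_le_exp (x := b / (2 * s)) (by positivity) N
      rw [div_le_iff₀ (by positivity)] at h2
      have h3 : Real.exp (b / (2 * s)) * Real.exp (-b / (2 * s)) = 1 := by
        rw [← Real.exp_add]; ring_nf; simp
      calc igKernel a b s ≤ ((2 / b) ^ N * (Real.exp (b / (2 * s)) * N.factorial))
            * Real.exp (-b / (2 * s)) := by unfold igKernel; gcongr; exact h1.trans (by gcongr)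
        _ = (2 / b) ^ N * N.factorial * (Real.exp (b / (2 * s)) * Real.exp (-b / (2 * s))) := by
            ring
        _ = _ := by rw [h3, mul_one]
    calc ∫⁻ s in Set.Ioc (0 : ℝ) 1, ENNReal.ofReal (igKernel a b s)
        ≤ ∫⁻ _ in Set.Ioc (0 : ℝ) 1, ENNReal.ofReal ((2 / b) ^ N * N.factorial) :=
          setLIntegral_mono measurable_const hle
      _ < ∞ := by simp
  · have h := (integrableOn_Ioi_rpow_of_lt (a := -a / 2 - 1) (by linarith) one_pos).lintegral_lt_top
    refine (setLIntegral_mono (by fun_prop) fun s hs => ?_).trans_lt h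
    have hs0 : (0 : ℝ) < s := zero_lt_one.trans hs
    refine ENNReal.ofReal_le_ofReal (mul_le_of_le_one_right (by positivity) ?_)
    exact Real.exp_le_one_iff.2 (div_nonpos_of_nonpos_of_nonneg (by linarith) (by positivity))

/-- Lebesgue measure on the region of positive error variances and local scales. -/
def hyperMeasure (n : ℕ) : Measure (ℝ × (Fin n → ℝ)) :=
  (volume.restrict (Set.Ioi 0)).prod (volume.restrict {l | ∀ i, 0 < l i})

instance (n : ℕ) : SFinite (hyperMeasure n) := by unfold hyperMeasure; infer_instance

theorem measurableSet_orthant (n : ℕ) : MeasurableSet {l : Fin n → ℝ | ∀ i, 0 < l i} := by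
  measurability

theorem ae_hyperMeasure (n : ℕ) : ∀ᵐ v ∂hyperMeasure n, 0 < v.1 ∧ ∀ i, 0 < v.2 i := by
  rw [hyperMeasure, Measure.prod_restrict]
  exact ae_restrict_mem (measurableSet_Ioi.prod (measurableSet_orthant n))

theorem lintegral_posSet {n : ℕ} (F : (Fin n → ℝ) × ℝ × (Fin n → ℝ) → ℝ≥0∞) (hF : Measurable F) :
    ∫⁻ p in Model.posSet n, F p = ∫⁻ v, (∫⁻ β, F (β, v)) ∂hyperMeasure n := by
  have hset : (Model.posSet n) = Set.univ ×ˢ (Set.Ioi 0 ×ˢ {l : Fin n → ℝ | ∀ i, 0 < l i}) := by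
    ext p; simp [Model.posSet]
  rw [hset, Measure.volume_eq_prod, ← Measure.prod_restrict, Measure.restrict_univ,
    Measure.volume_eq_prod, ← Measure.prod_restrict, lintegral_prod_symm' _ hF]
  rfl

theorem measurableSet_posSet (n : ℕ) : MeasurableSet (Model.posSet n) := by
  have : Model.posSet n = Set.univ ×ˢ (Set.Ioi 0 ×ˢ {l : Fin n → ℝ | ∀ i, 0 < l i}) := by
    ext p; simp [Model.posSet]
  rw [this]
  exact MeasurableSet.univ.prod (measurableSet_Ioi.prod (measurableSet_orthant n))

/-- The part of the unnormalized joint posterior density that depends only on the error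
variance and the local scales. -/
def hyperWeight (M : Model) (n : ℕ) (v : ℝ × (Fin n → ℝ)) : ℝ :=
  igKernel M.a M.b v.1 * ((√v.1 ^ n)⁻¹ * (√v.1 ^ n)⁻¹) * ∏ i, (M.pr (v.2 i) * (√(v.2 i))⁻¹)

/-- The Gaussian exponential factor of the unnormalized joint posterior density. -/
def gaussFactor (M : Model) (n : ℕ) (Y β : Fin n → ℝ) (v : ℝ × (Fin n → ℝ)) : ℝ :=
  Real.exp (-((sqnorm (Y - M.K n *ᵥ β) + ∑ i, 1 / (M.τsq n * v.2 i) * β i ^ 2) / (2 * v.1)))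

theorem jd_eq (M : Model) (n : ℕ) (Y β : Fin n → ℝ) {v : ℝ × (Fin n → ℝ)}
    (hs : 0 < v.1) (hl : ∀ i, 0 < v.2 i) :
    M.jd n Y β v.1 v.2 = hyperWeight M n v * gaussFactor M n Y β v := by
  obtain ⟨s, l⟩ := v
  simp only at hs hl
  unfold Model.jd hyperWeight gaussFactor igKernel
  simp only
  have h1 : s ^ (-(n : ℝ) - M.a / 2 - 1) = s ^ (-M.a / 2 - 1) * ((√s ^ n)⁻¹ * (√s ^ n)⁻¹) := by
    rw [← mul_inv, ← mul_pow, Real.mul_self_sqrt hs.le, ← Real.rpow_natCast, ← Real.rpow_neg hs.le,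
      ← Real.rpow_add hs]
    congr 1; ring
  have h2 : (∏ i, l i) ^ (-(1 : ℝ) / 2) = ∏ i, (√(l i))⁻¹ := by
    rw [← Real.finsetProd_rpow _ _ fun i _ => (hl i).le]
    refine Finset.prod_congr rfl fun i _ => ?_
    rw [neg_div, Real.rpow_neg (hl i).le, Real.sqrt_eq_rpow]
  have h3 : Real.exp ((-M.b - (M.τsq n)⁻¹ * ∑ i, (β i) ^ 2 / l i
        - sqnorm (Y - M.K n *ᵥ β)) / (2 * s)) = Real.exp (-M.b / (2 * s)) *
      Real.exp (-((sqnorm (Y - M.K n *ᵥ β) + ∑ i, 1 / (M.τsq n * l i) * β i ^ 2) / (2 * s))) := by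
    rw [← Real.exp_add, Finset.mul_sum]
    have : ∀ i, (M.τsq n)⁻¹ * ((β i) ^ 2 / l i) = 1 / (M.τsq n * l i) * β i ^ 2 := fun i => by
      rw [one_div, mul_inv]; ring
    simp_rw [this]
    congr 1; ring
  rw [h1, h2, h3, Finset.prod_mul_distrib]
  ring

theorem hyperWeight_nonneg (M : Model) (n : ℕ) {v : ℝ × (Fin n → ℝ)} (hs : 0 < v.1) :
    0 ≤ hyperWeight M n v := by
  have h := igKernel_nonneg (a := M.a) (b := M.b) hs.le
  have h2 := Finset.prod_nonneg fun i (_ : i ∈ Finset.univ) =>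
    mul_nonneg (M.hpr_nonneg (v.2 i)) (inv_nonneg.2 (Real.sqrt_nonneg (v.2 i)))
  unfold hyperWeight
  positivity

theorem measurable_hyperWeight {M : Model} (hM : Measurable M.pr) (n : ℕ) :
    Measurable (hyperWeight M n) := by
  have := measurable_igKernel M.a M.b
  unfold hyperWeight; fun_prop

theorem measurable_gaussFactor (M : Model) (n : ℕ) :
    Measurable fun p : (Fin n → ℝ) × (Fin n → ℝ) × ℝ × (Fin n → ℝ) =>
      gaussFactor M n p.1 p.2.1 p.2.2 := by
  have h : Measurable fun p : (Fin n → ℝ) × (Fin n → ℝ) × ℝ × (Fin n → ℝ) =>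
      sqnorm (p.1 - M.K n *ᵥ p.2.1) := by
    have : Continuous fun p : (Fin n → ℝ) × (Fin n → ℝ) × ℝ × (Fin n → ℝ) =>
        sqnorm (p.1 - M.K n *ᵥ p.2.1) := by
      have := @continuous_sqnorm n
      fun_prop
    exact this.measurable
  unfold gaussFactor
  fun_prop

/-- Likelihood of the hyperparameters: the Gaussian factor integrated over the coefficients. -/
def lik (M : Model) (n : ℕ) (Y : Fin n → ℝ) (v : ℝ × (Fin n → ℝ)) : ℝ≥0∞ :=
  ∫⁻ β, ENNReal.ofReal (gaussFactor M n Y β v)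

theorem measurable_lik (M : Model) (n : ℕ) :
    Measurable fun p : (Fin n → ℝ) × ℝ × (Fin n → ℝ) => lik M n p.1 p.2 := by
  unfold lik
  refine Measurable.lintegral_prod_right'
    (f := fun q : ((Fin n → ℝ) × ℝ × (Fin n → ℝ)) × (Fin n → ℝ) =>
      ENNReal.ofReal (gaussFactor M n q.1.1 q.2 q.1.2)) ?_
  exact ((measurable_gaussFactor M n).comp
    (by fun_prop : Measurable fun q : ((Fin n → ℝ) × ℝ × (Fin n → ℝ)) × (Fin n → ℝ) =>
      (q.1.1, q.2, q.1.2))).ennreal_ofReal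

theorem measurable_lik_left (M : Model) (n : ℕ) (v : ℝ × (Fin n → ℝ)) :
    Measurable fun Y => lik M n Y v :=
  (measurable_lik M n).of_uncurry_right

/-- Joint mass of data in `Ω` and coefficients, at fixed hyperparameters. -/
theorem lintegral_lik_le {M : Model} {n : ℕ} (hτ : 0 < M.τsq n) {v : ℝ × (Fin n → ℝ)}
    (hs : 0 < v.1) (hl : ∀ i, 0 < v.2 i) {Ω : Set (Fin n → ℝ)} {κ : ℝ≥0∞}
    (hκ : ∀ m, ∫⁻ Y in Ω, ENNReal.ofReal (Real.exp (-(sqnorm (Y - m) / (2 * v.1))))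
      ≤ κ * ENNReal.ofReal (√v.1 ^ n)) :
    ∫⁻ Y in Ω, ENNReal.ofReal (hyperWeight M n v) * lik M n Y v
      ≤ κ * ENNReal.ofReal (√(2 * Real.pi * M.τsq n) ^ n) *
        (ENNReal.ofReal (igKernel M.a M.b v.1) * ∏ i, ENNReal.ofReal (M.pr (v.2 i))) := by
  obtain ⟨s, l⟩ := v
  simp only at hs hl hκ
  have hmeas : Measurable fun q : (Fin n → ℝ) × (Fin n → ℝ) =>
      ENNReal.ofReal (gaussFactor M n q.1 q.2 (s, l)) :=
    ((measurable_gaussFactor M n).comp (by fun_prop :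
      Measurable fun q : (Fin n → ℝ) × (Fin n → ℝ) => (q.1, q.2, s, l))).ennreal_ofReal
  have hlikm := measurable_lik_left M n (s, l)
  rw [lintegral_const_mul _ hlikm]
  unfold lik
  rw [lintegral_lintegral_swap hmeas.aemeasurable]
  set e : Fin n → ℝ := fun i => 1 / (M.τsq n * l i) with he
  have hep : ∀ i, 0 < e i := fun i => one_div_pos.2 (mul_pos hτ (hl i))
  have hin : ∀ β : Fin n → ℝ, ∫⁻ Y in Ω, ENNReal.ofReal (gaussFactor M n Y β (s, l))
      ≤ κ * ENNReal.ofReal (√s ^ n) *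
        ENNReal.ofReal (Real.exp (-((∑ i, e i / s * β i ^ 2) / 2))) := by
    intro β
    have hsplit : ∀ Y, ENNReal.ofReal (gaussFactor M n Y β (s, l))
        = ENNReal.ofReal (Real.exp (-((∑ i, e i / s * β i ^ 2) / 2))) *
          ENNReal.ofReal (Real.exp (-(sqnorm (Y - M.K n *ᵥ β) / (2 * s)))) := fun Y => by
      rw [← ENNReal.ofReal_mul (Real.exp_pos _).le, ← Real.exp_add, gaussFactor]
      congr 2
      have : ∑ i, e i / s * β i ^ 2 = (∑ i, e i * β i ^ 2) / s := by
        rw [Finset.sum_div]; exact Finset.sum_congr rfl fun i _ => by ring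
      rw [this]
      simp only [he]
      field_simp
      ring
    simp_rw [hsplit]
    have hm : Measurable fun Y => ENNReal.ofReal
        (Real.exp (-(sqnorm (Y - M.K n *ᵥ β) / (2 * s)))) := by
      have := (@continuous_sqnorm n).measurable
      fun_prop
    rw [lintegral_const_mul _ hm, mul_comm]
    gcongr
    exact hκ _
  have hprod : ∏ i, √(2 * Real.pi / (e i / s))
      = √s ^ n * √(2 * Real.pi * M.τsq n) ^ n * ∏ i, √(l i) := by
    rw [← mul_pow, ← Fin.prod_const, ← Finset.prod_mul_distrib]
    refine Finset.prod_congr rfl fun i _ => ?_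
    rw [← Real.sqrt_mul hs.le, ← Real.sqrt_mul (by have := Real.pi_pos; positivity)]
    congr 1
    simp only [he]
    have := hl i
    field_simp
  calc ENNReal.ofReal (hyperWeight M n (s, l)) *
        ∫⁻ β, ∫⁻ Y in Ω, ENNReal.ofReal (gaussFactor M n Y β (s, l))
      ≤ ENNReal.ofReal (hyperWeight M n (s, l)) * ∫⁻ β : Fin n → ℝ, κ * ENNReal.ofReal (√s ^ n) *
          ENNReal.ofReal (Real.exp (-((∑ i, e i / s * β i ^ 2) / 2))) := by
        gcongr with β
        exact hin β
    _ = κ * (ENNReal.ofReal (hyperWeight M n (s, l)) * ENNReal.ofReal (√s ^ n) *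
          ENNReal.ofReal (√s ^ n * √(2 * Real.pi * M.τsq n) ^ n * ∏ i, √(l i))) := by
        rw [lintegral_const_mul _ (by fun_prop), lintegral_exp_neg_diag _
          fun i => div_pos (hep i) hs, hprod]
        ring
    _ = _ := by
        have hg := igKernel_nonneg (a := M.a) (b := M.b) hs.le
        have hw := hyperWeight_nonneg M n (v := (s, l)) hs
        rw [← ENNReal.ofReal_mul hw, ← ENNReal.ofReal_mul (by positivity),
          ← ENNReal.ofReal_prod_of_nonneg fun i _ => M.hpr_nonneg _,
          ← ENNReal.ofReal_mul hg, mul_assoc κ, ← ENNReal.ofReal_mul (by positivity)]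
        congr 2
        simp only [hyperWeight, Finset.prod_mul_distrib]
        have h1 : √s ^ n ≠ 0 := (pow_pos (Real.sqrt_pos.2 hs) n).ne'
        have h2 : (∏ i, (√(l i))⁻¹) * ∏ i, √(l i) = 1 := by
          rw [← Finset.prod_mul_distrib]
          exact Finset.prod_eq_one fun i _ => inv_mul_cancel₀ (Real.sqrt_pos.2 (hl i)).ne'
        calc _ = igKernel M.a M.b s * ((√s ^ n)⁻¹ * √s ^ n) * ((√s ^ n)⁻¹ * √s ^ n)
              * (∏ i, M.pr (l i)) * √(2 * Real.pi * M.τsq n) ^ n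
              * ((∏ i, (√(l i))⁻¹) * ∏ i, √(l i)) := by ring
          _ = _ := by rw [h2, inv_mul_cancel₀ h1]; ring

/-- Joint mass of data in `Ω` and hyperparameters in `D`. -/
theorem lintegral_mass_le {M : Model} (hM : Measurable M.pr) {n : ℕ} (hτ : 0 < M.τsq n)
    {Ω : Set (Fin n → ℝ)} {D : Set (ℝ × (Fin n → ℝ))} (hD : MeasurableSet D) {κ : ℝ≥0∞}
    (hκ : ∀ v ∈ D, 0 < v.1 → ∀ m,
      ∫⁻ Y in Ω, ENNReal.ofReal (Real.exp (-(sqnorm (Y - m) / (2 * v.1))))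
      ≤ κ * ENNReal.ofReal (√v.1 ^ n)) :
    ∫⁻ Y in Ω, ∫⁻ v in D, ENNReal.ofReal (hyperWeight M n v) * lik M n Y v ∂hyperMeasure n
      ≤ κ * ENNReal.ofReal (√(2 * Real.pi * M.τsq n) ^ n) *
        ∫⁻ v in D, ENNReal.ofReal (igKernel M.a M.b v.1) *
          ∏ i, ENNReal.ofReal (M.pr (v.2 i)) ∂hyperMeasure n := by
  have hmeas : Measurable fun q : (Fin n → ℝ) × (ℝ × (Fin n → ℝ)) =>
      ENNReal.ofReal (hyperWeight M n q.2) * lik M n q.1 q.2 :=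
    ((measurable_hyperWeight hM n).comp measurable_snd).ennreal_ofReal.mul (measurable_lik M n)
  rw [lintegral_lintegral_swap hmeas.aemeasurable]
  have hm2 : Measurable fun v : ℝ × (Fin n → ℝ) => ENNReal.ofReal (igKernel M.a M.b v.1) *
      ∏ i, ENNReal.ofReal (M.pr (v.2 i)) := by
    have := measurable_igKernel M.a M.b
    fun_prop
  rw [← lintegral_const_mul _ hm2]
  refine lintegral_mono_ae ?_
  filter_upwards [ae_restrict_mem hD, ae_restrict_of_ae (ae_hyperMeasure n)] with v hvD hv
  exact lintegral_lik_le hτ hv.1 hv.2 (hκ v hvD hv.1)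

theorem lintegral_orthant_prod {n : ℕ} (f : Fin n → ℝ → ℝ≥0∞) (hf : ∀ i, Measurable (f i)) :
    ∫⁻ l in {l : Fin n → ℝ | ∀ i, 0 < l i}, ∏ i, f i (l i)
      = ∏ i, ∫⁻ t in Set.Ioi 0, f i t := by
  rw [← lintegral_indicator (measurableSet_orthant n)]
  simp_rw [← lintegral_indicator measurableSet_Ioi]
  rw [← lintegral_pi_prod _ fun i => (hf i).indicator measurableSet_Ioi]
  refine lintegral_congr fun l => ?_
  by_cases h : ∀ i, 0 < l i
  · rw [Set.indicator_of_mem (by exact h)]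
    exact Finset.prod_congr rfl fun i _ => (Set.indicator_of_mem (Set.mem_Ioi.2 (h i)) _).symm
  · rw [Set.indicator_of_notMem (by exact h)]
    push Not at h
    obtain ⟨i, hi⟩ := h
    exact (Finset.prod_eq_zero (Finset.mem_univ i)
      (Set.indicator_of_notMem (s := Set.Ioi 0) (a := l i) (not_lt.2 hi) _)).symm

/-- A Jensen-type lower bound for the prior expectation of `(1 + cλ²)^{-1/2}`. -/
theorem exp_neg_le_lintegral_rsqrt {pr : ℝ → ℝ} (h0 : ∀ x, 0 ≤ pr x)
    (hone : ∫ x in Set.Ioi (0 : ℝ), pr x = 1) (hint : IntegrableOn pr (Set.Ioi 0))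
    (hint1 : IntegrableOn (fun x => x * pr x) (Set.Ioi 0)) {c : ℝ} (hc : 0 ≤ c) :
    ENNReal.ofReal (Real.exp (-(c * (∫ x in Set.Ioi (0 : ℝ), x * pr x) / 2)))
      ≤ ∫⁻ x in Set.Ioi (0 : ℝ), ENNReal.ofReal (pr x * (√(1 + c * x))⁻¹) := by
  set μ := ∫ x in Set.Ioi (0 : ℝ), x * pr x with hμ
  set E := Real.exp (-(c * μ / 2)) with hE
  have hf : IntegrableOn (fun x => E * ((1 + c * μ / 2) * pr x - c / 2 * (x * pr x)))
      (Set.Ioi 0) := ((hint.const_mul _).sub (hint1.const_mul _)).const_mul _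
  have hval : ∫ x in Set.Ioi (0 : ℝ), E * ((1 + c * μ / 2) * pr x - c / 2 * (x * pr x)) = E := by
    rw [integral_const_mul, integral_sub (hint.const_mul _) (hint1.const_mul _),
      integral_const_mul, integral_const_mul, hone, ← hμ]
    ring
  have hmeas : AEStronglyMeasurable (fun x => pr x * (√(1 + c * x))⁻¹)
      (volume.restrict (Set.Ioi 0)) :=
    hint.aestronglyMeasurable.mul (by fun_prop : Measurable fun x : ℝ =>
      (√(1 + c * x))⁻¹).aestronglyMeasurable
  have hone_le : ∀ x ∈ Set.Ioi (0 : ℝ), (√(1 + c * x))⁻¹ ≤ 1 := fun x hx => by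
    refine inv_le_one_of_one_le₀ (Real.one_le_sqrt.2 ?_)
    nlinarith [Set.mem_Ioi.1 hx]
  have hg : IntegrableOn (fun x => pr x * (√(1 + c * x))⁻¹) (Set.Ioi 0) := by
    refine Integrable.mono hint hmeas ?_
    filter_upwards [ae_restrict_mem measurableSet_Ioi] with x hx
    rw [Real.norm_of_nonneg (h0 x), Real.norm_of_nonneg (mul_nonneg (h0 x) (by positivity))]
    exact mul_le_of_le_one_right (h0 x) (hone_le x hx)
  rw [← ofReal_integral_eq_lintegral_ofReal hg
    (ae_of_all _ fun x => mul_nonneg (h0 x) (by positivity))]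
  refine ENNReal.ofReal_le_ofReal ?_
  rw [← hval]
  refine setIntegral_mono_on hf hg measurableSet_Ioi fun x hx => ?_
  have hx0 : (0 : ℝ) < x := hx
  have hcx : 0 ≤ c * x := mul_nonneg hc hx0.le
  have h1 : Real.exp (-(c * x / 2)) ≤ (√(1 + c * x))⁻¹ := by
    rw [Real.exp_neg]
    refine inv_anti₀ (Real.sqrt_pos.2 (by linarith)) ?_
    rw [Real.sqrt_le_left (Real.exp_pos _).le, ← Real.exp_nat_mul]
    have := Real.add_one_le_exp (c * x)
    convert (by linarith : 1 + c * x ≤ Real.exp (c * x)) using 2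
    push_cast; ring
  have h2 : E * (1 + c * μ / 2 - c / 2 * x) ≤ Real.exp (-(c * x / 2)) := by
    have h3 := Real.add_one_le_exp (c * μ / 2 - c * x / 2)
    calc E * (1 + c * μ / 2 - c / 2 * x) ≤ E * Real.exp (c * μ / 2 - c * x / 2) := by
          gcongr; linarith
      _ = _ := by rw [hE, ← Real.exp_add]; congr 1; ring
  calc E * ((1 + c * μ / 2) * pr x - c / 2 * (x * pr x))
      = pr x * (E * (1 + c * μ / 2 - c / 2 * x)) := by ring
    _ ≤ _ := mul_le_mul_of_nonneg_left (h2.trans h1) (h0 x)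

/-- Pointwise lower bound for the weighted likelihood of the hyperparameters. -/
theorem le_hyperWeight_mul_lik {M : Model} {n : ℕ} (hn : 0 < n) (hτ : 0 < M.τsq n) {c₂ : ℝ}
    (hup : ∀ v, sqnorm (M.K n *ᵥ v) ≤ c₂ ^ 2 * sqnorm v) (Y : Fin n → ℝ) {σ : ℝ} (hσ : 0 < σ)
    {v : ℝ × (Fin n → ℝ)} (hv₁ : σ ≤ v.1) (hv₂ : v.1 ≤ σ * (1 + 1 / n)) (hl : ∀ i, 0 < v.2 i) :
    ENNReal.ofReal ((2 * σ) ^ (-M.a / 2 - 1) * Real.exp (-M.b / (2 * σ)) * Real.exp (-(1 / 2)) *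
        (√σ ^ n)⁻¹ * Real.exp (-(sqnorm Y / (2 * σ))) * √(2 * Real.pi * M.τsq n) ^ n) *
      ∏ i, ENNReal.ofReal (M.pr (v.2 i) * (√(1 + c₂ ^ 2 * M.τsq n * v.2 i))⁻¹)
      ≤ ENNReal.ofReal (hyperWeight M n v) * lik M n Y v := by
  obtain ⟨s, l⟩ := v
  simp only at hv₁ hv₂ hl
  have hs : 0 < s := hσ.trans_le hv₁
  have hn' : (1 : ℝ) ≤ n := by exact_mod_cast hn
  have hw := hyperWeight_nonneg M n (v := (s, l)) hs
  have hep : ∀ i, 0 < 1 / (M.τsq n * l i) := fun i => one_div_pos.2 (mul_pos hτ (hl i))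
  have hlik : ENNReal.ofReal (Real.exp (-(sqnorm Y / (2 * s))) *
      ∏ i, √(2 * Real.pi * s / (c₂ ^ 2 + 1 / (M.τsq n * l i)))) ≤ lik M n Y (s, l) :=
    le_lintegral_symmetrized hup hep Y hs
  refine le_trans ?_ (mul_le_mul_right hlik _)
  have hnn : ∀ i, 0 ≤ M.pr (l i) * (√(1 + c₂ ^ 2 * M.τsq n * l i))⁻¹ := fun i =>
    mul_nonneg (M.hpr_nonneg _) (by positivity)
  rw [← ENNReal.ofReal_prod_of_nonneg fun i _ => hnn i, ← ENNReal.ofReal_mul (by positivity),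
    ← ENNReal.ofReal_mul hw]
  refine ENNReal.ofReal_le_ofReal ?_
  have hfac : ∀ i, √(2 * Real.pi * s / (c₂ ^ 2 + 1 / (M.τsq n * l i)))
      = √s * √(2 * Real.pi * M.τsq n) * √(l i) * (√(1 + c₂ ^ 2 * M.τsq n * l i))⁻¹ := fun i => by
    have := hl i
    have hpi := Real.pi_pos
    rw [← Real.sqrt_mul hs.le, ← Real.sqrt_mul (by positivity), ← Real.sqrt_inv,
      ← Real.sqrt_mul (by positivity)]
    congr 1
    have h1 : 0 < 1 + c₂ ^ 2 * M.τsq n * l i := by positivity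
    have h2 : c₂ ^ 2 + 1 / (M.τsq n * l i) = (1 + c₂ ^ 2 * M.τsq n * l i) / (M.τsq n * l i) := by
      field_simp
      ring
    rw [h2]
    field_simp
  have hexp1 : (1 : ℝ) + 1 / n ≤ 2 := by
    have : (1 : ℝ) / n ≤ 1 := by rw [div_le_one (by linarith)]; exact hn'
    linarith
  have hs2 : s ≤ 2 * σ := hv₂.trans (by nlinarith)
  have hk : (2 * σ) ^ (-M.a / 2 - 1) * Real.exp (-M.b / (2 * σ)) ≤ igKernel M.a M.b s := by
    unfold igKernel
    have hb := M.hb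
    have ha := M.ha
    have h1 : (2 * σ) ^ (-M.a / 2 - 1) ≤ s ^ (-M.a / 2 - 1) :=
      Real.rpow_le_rpow_of_nonpos hs hs2 (by linarith)
    have h2 : Real.exp (-M.b / (2 * σ)) ≤ Real.exp (-M.b / (2 * s)) := by
      refine Real.exp_le_exp.2 ?_
      rw [neg_div, neg_div, neg_le_neg_iff]
      gcongr
    gcongr
  have hroot : Real.exp (-(1 / 2)) * (√σ ^ n)⁻¹ ≤ (√s ^ n)⁻¹ := by
    have h1 : √s ≤ √σ * Real.exp (1 / (2 * n)) := by
      rw [Real.sqrt_le_left (by positivity), mul_pow, Real.sq_sqrt hσ.le, ← Real.exp_nat_mul]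
      refine hv₂.trans ?_
      have h2 : ((2 : ℕ) : ℝ) * (1 / (2 * n)) = 1 / n := by push_cast; field_simp
      rw [h2]
      have := Real.add_one_le_exp (1 / (n : ℝ))
      gcongr
      linarith
    have h3 : √s ^ n ≤ √σ ^ n * Real.exp (1 / 2) := by
      refine (pow_le_pow_left₀ (Real.sqrt_nonneg _) h1 n).trans_eq ?_
      rw [mul_pow, ← Real.exp_nat_mul]
      congr 2
      field_simp
    have hsn : 0 < √s ^ n := pow_pos (Real.sqrt_pos.2 hs) n
    refine le_trans (le_of_eq ?_) (inv_anti₀ hsn h3)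
    rw [mul_inv, Real.exp_neg, mul_comm]
  have hY : Real.exp (-(sqnorm Y / (2 * σ))) ≤ Real.exp (-(sqnorm Y / (2 * s))) := by
    have := sqnorm_nonneg Y
    refine Real.exp_le_exp.2 (neg_le_neg ?_)
    gcongr
  have hP : 0 ≤ ∏ i, M.pr (l i) * (√(1 + c₂ ^ 2 * M.τsq n * l i))⁻¹ :=
    Finset.prod_nonneg fun i _ => hnn i
  have hτn : 0 ≤ √(2 * Real.pi * M.τsq n) ^ n := by positivity
  have hg : 0 ≤ igKernel M.a M.b s := igKernel_nonneg hs.le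
  calc (2 * σ) ^ (-M.a / 2 - 1) * Real.exp (-M.b / (2 * σ)) * Real.exp (-(1 / 2)) *
        (√σ ^ n)⁻¹ * Real.exp (-(sqnorm Y / (2 * σ))) * √(2 * Real.pi * M.τsq n) ^ n *
        ∏ i, M.pr (l i) * (√(1 + c₂ ^ 2 * M.τsq n * l i))⁻¹
      = ((2 * σ) ^ (-M.a / 2 - 1) * Real.exp (-M.b / (2 * σ))) * (Real.exp (-(1 / 2)) *
        (√σ ^ n)⁻¹) * Real.exp (-(sqnorm Y / (2 * σ))) * √(2 * Real.pi * M.τsq n) ^ n *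
        ∏ i, M.pr (l i) * (√(1 + c₂ ^ 2 * M.τsq n * l i))⁻¹ := by ring
    _ ≤ igKernel M.a M.b s * (√s ^ n)⁻¹ * Real.exp (-(sqnorm Y / (2 * s))) *
        √(2 * Real.pi * M.τsq n) ^ n *
        ∏ i, M.pr (l i) * (√(1 + c₂ ^ 2 * M.τsq n * l i))⁻¹ := by gcongr
    _ = _ := by
        simp_rw [hfac]
        simp only [hyperWeight, Finset.prod_mul_distrib, Fin.prod_const]
        have h1 : √s ^ n ≠ 0 := (pow_pos (Real.sqrt_pos.2 hs) n).ne'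
        have h2 : (∏ i, (√(l i))⁻¹) * ∏ i, √(l i) = 1 := by
          rw [← Finset.prod_mul_distrib]
          exact Finset.prod_eq_one fun i _ => inv_mul_cancel₀ (Real.sqrt_pos.2 (hl i)).ne'
        symm
        calc _ = igKernel M.a M.b s * (√s ^ n)⁻¹ * Real.exp (-(sqnorm Y / (2 * s))) *
              √(2 * Real.pi * M.τsq n) ^ n * ((∏ i, M.pr (l i)) *
              ∏ i, (√(1 + c₂ ^ 2 * M.τsq n * l i))⁻¹) * ((√s ^ n)⁻¹ * √s ^ n) *
              ((∏ i, (√(l i))⁻¹) * ∏ i, √(l i)) := by ring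
          _ = _ := by rw [h2, inv_mul_cancel₀ h1]; ring

/-- Lower bound for the marginal likelihood of the data. -/
theorem le_marginal {M : Model} (hM : Measurable M.pr) {n : ℕ} (hn : 0 < n) (hτ : 0 < M.τsq n)
    {c₂ : ℝ} (hup : ∀ v, sqnorm (M.K n *ᵥ v) ≤ c₂ ^ 2 * sqnorm v)
    (hint : IntegrableOn M.pr (Set.Ioi 0))
    (hint1 : IntegrableOn (fun x => x * M.pr x) (Set.Ioi 0)) (Y : Fin n → ℝ) {σ : ℝ} (hσ : 0 < σ) :
    ENNReal.ofReal (σ / n * ((2 * σ) ^ (-M.a / 2 - 1) * Real.exp (-M.b / (2 * σ)) *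
        Real.exp (-(1 / 2)) * (√σ ^ n)⁻¹ * Real.exp (-(sqnorm Y / (2 * σ))) *
        √(2 * Real.pi * M.τsq n) ^ n) *
        Real.exp (-(n * (c₂ ^ 2 * M.τsq n * (∫ x in Set.Ioi (0 : ℝ), x * M.pr x) / 2))))
      ≤ ∫⁻ v, ENNReal.ofReal (hyperWeight M n v) * lik M n Y v ∂hyperMeasure n := by
  set B := (2 * σ) ^ (-M.a / 2 - 1) * Real.exp (-M.b / (2 * σ)) *
        Real.exp (-(1 / 2)) * (√σ ^ n)⁻¹ * Real.exp (-(sqnorm Y / (2 * σ))) *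
        √(2 * Real.pi * M.τsq n) ^ n with hB
  have hn' : (0 : ℝ) < n := by exact_mod_cast hn
  have hBp : 0 ≤ B := by positivity
  set I := Set.Icc σ (σ * (1 + 1 / n))
  have hIpos : I ⊆ Set.Ioi 0 := fun s hs => hσ.trans_le hs.1
  set f : ℝ → ℝ≥0∞ := I.indicator fun _ => ENNReal.ofReal B with hf
  set g : ℝ → ℝ≥0∞ := fun t => ENNReal.ofReal (M.pr t * (√(1 + c₂ ^ 2 * M.τsq n * t))⁻¹) with hg
  have hgm : Measurable g := by fun_prop
  have hfI : ∫⁻ s in Set.Ioi 0, f s = ENNReal.ofReal (σ / n * B) := by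
    rw [hf, lintegral_indicator_const measurableSet_Icc,
      Measure.restrict_apply measurableSet_Icc, Set.inter_eq_left.2 hIpos, Real.volume_Icc,
      ← ENNReal.ofReal_mul hBp]
    congr 1
    field_simp
    ring
  have hgI : ENNReal.ofReal (Real.exp
      (-(n * (c₂ ^ 2 * M.τsq n * (∫ x in Set.Ioi (0 : ℝ), x * M.pr x) / 2))))
      ≤ ∫⁻ l in {l : Fin n → ℝ | ∀ i, 0 < l i}, ∏ i, g (l i) := by
    rw [lintegral_orthant_prod _ fun _ => hgm, Fin.prod_const, ← mul_neg, Real.exp_nat_mul,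
      ENNReal.ofReal_pow (Real.exp_pos _).le]
    gcongr
    exact exp_neg_le_lintegral_rsqrt M.hpr_nonneg M.hpr_int hint hint1 (by positivity)
  calc ENNReal.ofReal (σ / n * B * _) ≤ (∫⁻ s in Set.Ioi 0, f s) *
        ∫⁻ l in {l : Fin n → ℝ | ∀ i, 0 < l i}, ∏ i, g (l i) := by
        rw [ENNReal.ofReal_mul (by positivity), hfI]
        gcongr
    _ = ∫⁻ v, f v.1 * ∏ i, g (v.2 i) ∂hyperMeasure n := by
        rw [hyperMeasure, ← lintegral_prod_mul]
        · exact (measurable_const.indicator measurableSet_Icc).aemeasurable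
        · exact (by fun_prop : Measurable fun l : Fin n → ℝ => ∏ i, g (l i)).aemeasurable
    _ ≤ _ := by
        refine lintegral_mono_ae ?_
        filter_upwards [ae_hyperMeasure n] with v hv
        by_cases hvI : v.1 ∈ I
        · rw [hf, Set.indicator_of_mem hvI]
          exact le_hyperWeight_mul_lik hn hτ hup Y hσ hvI.1 hvI.2 hv.2
        · rw [hf, Set.indicator_of_notMem hvI, zero_mul]
          exact zero_le

/-- If a sum of truncated scales is large, then either the small scales add up to a large number
or there are many large scales. -/
theorem one_le_of_le_sum_scales {n : ℕ} {a : Fin n → ℝ} (ha : ∀ i, 0 < a i) {c₁ x θ η : ℝ}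
    (hc₁ : 0 < c₁) (hx : 0 < x) (hθ : 0 < θ) (hη : 2 ≤ Real.exp η)
    (hsum : x ≤ ∑ i, 1 / (c₁ ^ 2 + 1 / a i)) :
    1 ≤ (∏ i, (1 + 2 * θ * a i)) * Real.exp (-(θ * x / 2)) +
      2 * ((∏ i, (1 + Real.exp η * θ ^ 2 * a i ^ 2)) - 1) * Real.exp (-(η * c₁ ^ 2 * x / 2)) := by
  have hη0 : 0 < η := by
    by_contra! h
    linarith [Real.exp_le_one_iff.2 h]
  have hG : ∀ i, 1 ≤ 1 + Real.exp η * θ ^ 2 * a i ^ 2 := fun i => by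
    have : 0 ≤ Real.exp η * θ ^ 2 * a i ^ 2 := by positivity
    linarith
  have hG1 : 1 ≤ ∏ i, (1 + Real.exp η * θ ^ 2 * a i ^ 2) := Finset.one_le_prod fun i _ => hG i
  have hH0 : 0 ≤ ∏ i, (1 + 2 * θ * a i) :=
    Finset.prod_nonneg fun i _ => by have := ha i; positivity
  rcases le_or_gt (x / 2) (∑ i, if θ * a i < 1 then a i else 0) with h | h
  · have h1 : Real.exp (θ * x / 2) ≤ ∏ i, (1 + 2 * θ * a i) := by
      calc Real.exp (θ * x / 2)
          ≤ Real.exp (∑ i, θ * if θ * a i < 1 then a i else 0) := by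
            rw [← Finset.mul_sum]
            refine Real.exp_le_exp.2 ?_
            nlinarith
        _ = ∏ i, Real.exp (θ * if θ * a i < 1 then a i else 0) := Real.exp_sum _ _
        _ ≤ _ := by
            refine Finset.prod_le_prod (fun i _ => (Real.exp_pos _).le) fun i _ => ?_
            have hpos := mul_pos hθ (ha i)
            split_ifs with hi
            · have := Real.abs_exp_sub_one_le (x := θ * a i) (by rw [abs_of_pos hpos]; exact hi.le)
              rw [abs_of_pos hpos] at this
              linarith [le_abs_self (Real.exp (θ * a i) - 1)]
            · rw [mul_zero, Real.exp_zero]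
              linarith
    have h2 : 1 ≤ (∏ i, (1 + 2 * θ * a i)) * Real.exp (-(θ * x / 2)) := by
      calc (1 : ℝ) = Real.exp (θ * x / 2) * Real.exp (-(θ * x / 2)) := by
            rw [← Real.exp_add, add_neg_cancel, Real.exp_zero]
        _ ≤ _ := by gcongr
    have h3 : 0 ≤ 2 * ((∏ i, (1 + Real.exp η * θ ^ 2 * a i ^ 2)) - 1) *
        Real.exp (-(η * c₁ ^ 2 * x / 2)) :=
      mul_nonneg (by linarith) (Real.exp_pos _).le
    linarith
  · set S := Finset.univ.filter fun i => ¬ θ * a i < 1 with hS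
    have hterm : ∀ i, 1 / (c₁ ^ 2 + 1 / a i)
        ≤ (if θ * a i < 1 then a i else 0) + 1 / c₁ ^ 2 * if ¬ θ * a i < 1 then 1 else 0 := by
      intro i
      have := ha i
      by_cases hi : θ * a i < 1
      · simp only [hi, if_true, not_true_eq_false, if_false, mul_zero, add_zero]
        rw [div_le_iff₀ (by positivity), mul_add, mul_one_div_cancel this.ne']
        have : 0 ≤ a i * c₁ ^ 2 := by positivity
        linarith
      · simp only [hi, if_false, not_false_eq_true, if_true, mul_one, zero_add]
        exact one_div_le_one_div_of_le (by positivity)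
          (le_add_of_nonneg_right (by positivity))
    have hN : c₁ ^ 2 * x / 2 ≤ S.card := by
      have h1 := hsum.trans (Finset.sum_le_sum fun i _ => hterm i)
      rw [Finset.sum_add_distrib, ← Finset.mul_sum, Finset.sum_boole, ← hS] at h1
      have h2 : x / 2 ≤ 1 / c₁ ^ 2 * S.card := by linarith
      rw [one_div, inv_mul_eq_div, le_div_iff₀ (by positivity)] at h2
      linarith
    have hN1 : (1 : ℝ) ≤ S.card := by
      have : (0 : ℝ) < S.card := lt_of_lt_of_le (by positivity) hN
      exact_mod_cast this
    have hGN : Real.exp (η * S.card) ≤ ∏ i, (1 + Real.exp η * θ ^ 2 * a i ^ 2) := by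
      calc Real.exp (η * S.card) = ∏ i, Real.exp (η * if ¬ θ * a i < 1 then 1 else 0) := by
            rw [← Real.exp_sum, ← Finset.mul_sum, Finset.sum_boole]
        _ ≤ _ := by
            refine Finset.prod_le_prod (fun i _ => (Real.exp_pos _).le) fun i _ => ?_
            by_cases hi : θ * a i < 1
            · simp only [hi, not_true_eq_false, if_false, mul_zero, Real.exp_zero]
              exact hG i
            · simp only [hi, not_false_eq_true, if_true, mul_one]
              have h1 : 1 ≤ (θ * a i) ^ 2 := one_le_pow₀ (not_lt.1 hi)
              rw [mul_assoc, ← mul_pow]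
              nlinarith [Real.exp_pos η]
    have h2 : 2 ≤ Real.exp (η * S.card) :=
      hη.trans (Real.exp_le_exp.2 (le_mul_of_one_le_right hη0.le hN1))
    have h3 : Real.exp (η * c₁ ^ 2 * x / 2) ≤ Real.exp (η * S.card) := by
      refine Real.exp_le_exp.2 ?_
      calc η * c₁ ^ 2 * x / 2 = η * (c₁ ^ 2 * x / 2) := by ring
        _ ≤ _ := by gcongr
    have h4 : 1 ≤ 2 * ((∏ i, (1 + Real.exp η * θ ^ 2 * a i ^ 2)) - 1) *
        Real.exp (-(η * c₁ ^ 2 * x / 2)) := by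
      calc (1 : ℝ) = Real.exp (η * c₁ ^ 2 * x / 2) * Real.exp (-(η * c₁ ^ 2 * x / 2)) := by
            rw [← Real.exp_add, add_neg_cancel, Real.exp_zero]
        _ ≤ _ := by
            gcongr
            linarith
    have h5 : 0 ≤ (∏ i, (1 + 2 * θ * a i)) * Real.exp (-(θ * x / 2)) := by positivity
    linarith

theorem lintegral_orthant_prior {pr φ : ℝ → ℝ} (hpr : Measurable pr) (hφ : Measurable φ)
    (h0 : ∀ x ∈ Set.Ioi (0 : ℝ), 0 ≤ pr x * φ x)
    (hint : IntegrableOn (fun x => pr x * φ x) (Set.Ioi 0)) (n : ℕ) :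
    ∫⁻ l in {l : Fin n → ℝ | ∀ i, 0 < l i}, ENNReal.ofReal (∏ i, (pr (l i) * φ (l i)))
      = ENNReal.ofReal ((∫ x in Set.Ioi (0 : ℝ), pr x * φ x) ^ n) := by
  have h1 : ∀ l ∈ {l : Fin n → ℝ | ∀ i, 0 < l i}, ENNReal.ofReal (∏ i, (pr (l i) * φ (l i)))
      = ∏ i, ENNReal.ofReal (pr (l i) * φ (l i)) := fun l hl =>
    ENNReal.ofReal_prod_of_nonneg fun i _ => h0 _ (hl i)
  rw [setLIntegral_congr_fun (measurableSet_orthant n) h1,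
    lintegral_orthant_prod (fun _ x => ENNReal.ofReal (pr x * φ x)) (fun _ => by fun_prop),
    Fin.prod_const, ← ofReal_integral_eq_lintegral_ofReal hint
      ((ae_restrict_mem measurableSet_Ioi).mono h0),
    ENNReal.ofReal_pow (setIntegral_nonneg measurableSet_Ioi h0)]

/-- Tail bound, under the prior, for the sum of truncated scales. -/
theorem lintegral_prior_tail_le {pr : ℝ → ℝ} (hpr : Measurable pr) (h0 : ∀ x, 0 ≤ pr x)
    (hone : ∫ x in Set.Ioi (0 : ℝ), pr x = 1) (hint : IntegrableOn pr (Set.Ioi 0))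
    (hint1 : IntegrableOn (fun x => x * pr x) (Set.Ioi 0))
    (hint2 : IntegrableOn (fun x => x ^ 2 * pr x) (Set.Ioi 0)) {n : ℕ} {τ c₁ x θ η : ℝ}
    (hτ : 0 < τ) (hc₁ : 0 < c₁) (hx : 0 < x) (hθ : 0 < θ) (hη : 2 ≤ Real.exp η) :
    ∫⁻ l in {l : Fin n → ℝ | ∀ i, 0 < l i} ∩ {l | x ≤ ∑ i, 1 / (c₁ ^ 2 + 1 / (τ * l i))},
        ∏ i, ENNReal.ofReal (pr (l i))
      ≤ ENNReal.ofReal (Real.exp (n * (2 * θ * τ * ∫ x in Set.Ioi (0 : ℝ), x * pr x)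
          - θ * x / 2)) +
        ENNReal.ofReal (2 * Real.exp (-(η * c₁ ^ 2 * x / 2)) *
          ((n * (Real.exp η * θ ^ 2 * τ ^ 2 * ∫ x in Set.Ioi (0 : ℝ), x ^ 2 * pr x)) *
          Real.exp (n * (Real.exp η * θ ^ 2 * τ ^ 2 * ∫ x in Set.Ioi (0 : ℝ), x ^ 2 * pr x)))) := by
  set μ := ∫ x in Set.Ioi (0 : ℝ), x * pr x
  set ν := ∫ x in Set.Ioi (0 : ℝ), x ^ 2 * pr x
  set k := Real.exp η * θ ^ 2 * τ ^ 2 with hk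
  have hk0 : 0 ≤ k := by positivity
  set φ : ℝ → ℝ := fun t => 1 + 2 * θ * (τ * t) with hφ
  set ψ : ℝ → ℝ := fun t => 1 + Real.exp η * θ ^ 2 * (τ * t) ^ 2 with hψ
  have hφI : IntegrableOn (fun t => pr t * φ t) (Set.Ioi 0) := by
    refine (hint.add (hint1.const_mul (2 * θ * τ))).congr (ae_of_all _ fun t => ?_)
    simp only [hφ, Pi.add_apply]; ring
  have hψI : IntegrableOn (fun t => pr t * ψ t) (Set.Ioi 0) := by
    refine (hint.add (hint2.const_mul k)).congr (ae_of_all _ fun t => ?_)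
    simp only [hψ, hk, Pi.add_apply]; ring
  have hφv : ∫ t in Set.Ioi (0 : ℝ), pr t * φ t = 1 + 2 * θ * τ * μ := by
    rw [← hone, ← integral_const_mul, ← integral_add hint (hint1.const_mul _)]
    exact integral_congr_ae (ae_of_all _ fun t => by simp only [hφ]; ring)
  have hψv : ∫ t in Set.Ioi (0 : ℝ), pr t * ψ t = 1 + k * ν := by
    rw [← hone, ← integral_const_mul, ← integral_add hint (hint2.const_mul _)]
    exact integral_congr_ae (ae_of_all _ fun t => by simp only [hψ, hk]; ring)
  have hμ : 0 ≤ μ := setIntegral_nonneg measurableSet_Ioi fun t ht => mul_nonneg ht.le (h0 t)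
  have hν : 0 ≤ ν := setIntegral_nonneg measurableSet_Ioi fun t _ => mul_nonneg (sq_nonneg _) (h0 t)
  have hφ0 : ∀ t ∈ Set.Ioi (0 : ℝ), 1 ≤ φ t := fun t ht => by
    have : 0 < t := ht
    have : 0 < 2 * θ * (τ * t) := by positivity
    simp only [hφ]; linarith
  have hψ0 : ∀ t, 1 ≤ ψ t := fun t => by
    have : 0 ≤ Real.exp η * θ ^ 2 * (τ * t) ^ 2 := by positivity
    simp only [hψ]; linarith
  have hpφ : ∀ t ∈ Set.Ioi (0 : ℝ), 0 ≤ pr t * φ t := fun t ht =>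
    mul_nonneg (h0 t) (zero_le_one.trans (hφ0 t ht))
  have hpψ : ∀ t ∈ Set.Ioi (0 : ℝ), 0 ≤ pr t * ψ t := fun t _ =>
    mul_nonneg (h0 t) (zero_le_one.trans (hψ0 t))
  have hΦ := lintegral_orthant_prior hpr (by fun_prop : Measurable φ) hpφ hφI n
  have hΨ := lintegral_orthant_prior hpr (by fun_prop : Measurable ψ) hpψ hψI n
  have h1 := lintegral_orthant_prior (φ := fun _ => 1) hpr measurable_const
    (fun t _ => mul_nonneg (h0 t) zero_le_one) (by simpa using hint) n
  simp only [mul_one, hone, one_pow, ENNReal.ofReal_one] at h1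
  rw [hφv] at hΦ
  rw [hψv] at hΨ
  set O := {l : Fin n → ℝ | ∀ i, 0 < l i} with hO
  set G : (Fin n → ℝ) → ℝ := fun l => (∏ i, pr (l i) * ψ (l i)) - ∏ i, pr (l i) with hG
  have hG0 : ∀ l, 0 ≤ G l := fun l => by
    simp only [hG, Finset.prod_mul_distrib]
    have := Finset.one_le_prod (s := Finset.univ) fun i _ => hψ0 (l i)
    have hP : 0 ≤ ∏ i, pr (l i) := Finset.prod_nonneg fun i _ => h0 _
    nlinarith
  have hGm : Measurable G := by fun_prop
  have hGI : ∫⁻ l in O, ENNReal.ofReal (G l)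
      ≤ ENNReal.ofReal (n * (k * ν) * Real.exp (n * (k * ν))) := by
    have h2 : (∫⁻ l in O, ENNReal.ofReal (G l)) + 1 = ENNReal.ofReal ((1 + k * ν) ^ n) := by
      rw [← hΨ, ← h1, ← lintegral_add_left hGm.ennreal_ofReal]
      refine lintegral_congr fun l => ?_
      rw [← ENNReal.ofReal_add (hG0 l) (Finset.prod_nonneg fun i _ => h0 _), hG,
        sub_add_cancel]
    have h3 : (1 + k * ν) ^ n ≤ 1 + n * (k * ν) * Real.exp (n * (k * ν)) := by
      have h4 : (1 + k * ν) ^ n ≤ Real.exp (n * (k * ν)) := by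
        rw [Real.exp_nat_mul]
        gcongr
        linarith [Real.add_one_le_exp (k * ν)]
      have h5 := Real.add_one_le_exp (-(n * (k * ν)))
      have h6 : Real.exp (n * (k * ν)) * Real.exp (-(n * (k * ν))) = 1 := by
        rw [← Real.exp_add, add_neg_cancel, Real.exp_zero]
      nlinarith [Real.exp_pos (n * (k * ν))]
    have h7 : (∫⁻ l in O, ENNReal.ofReal (G l)) + 1
        ≤ ENNReal.ofReal (n * (k * ν) * Real.exp (n * (k * ν))) + 1 := by
      rw [h2, ← ENNReal.ofReal_one, ← ENNReal.ofReal_add (by positivity) zero_le_one]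
      exact ENNReal.ofReal_le_ofReal (h3.trans_eq (add_comm _ _))
    exact (ENNReal.add_le_add_iff_right ENNReal.one_ne_top).1 h7
  set c₃ := Real.exp (-(θ * x / 2)) with hc₃
  set c₄ := 2 * Real.exp (-(η * c₁ ^ 2 * x / 2)) with hc₄
  have hpt : ∀ l ∈ O ∩ {l | x ≤ ∑ i, 1 / (c₁ ^ 2 + 1 / (τ * l i))},
      ∏ i, ENNReal.ofReal (pr (l i)) ≤ ENNReal.ofReal c₃ *
        ENNReal.ofReal (∏ i, pr (l i) * φ (l i)) + ENNReal.ofReal c₄ * ENNReal.ofReal (G l) := by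
    rintro l ⟨hl, hlx⟩
    have hP : 0 ≤ ∏ i, pr (l i) := Finset.prod_nonneg fun i _ => h0 _
    have hPφ : 0 ≤ ∏ i, pr (l i) * φ (l i) := Finset.prod_nonneg fun i _ => hpφ _ (hl i)
    rw [← ENNReal.ofReal_prod_of_nonneg fun i _ => h0 _, ← ENNReal.ofReal_mul (by positivity),
      ← ENNReal.ofReal_mul (by positivity),
      ← ENNReal.ofReal_add (by positivity) (mul_nonneg (by positivity) (hG0 l))]
    refine ENNReal.ofReal_le_ofReal ?_
    have h2 := one_le_of_le_sum_scales (fun i => mul_pos hτ (hl i)) hc₁ hx hθ hη hlx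
    calc ∏ i, pr (l i) ≤ (∏ i, pr (l i)) * _ := le_mul_of_one_le_right hP h2
      _ = _ := by
          simp only [hG, hφ, hψ, hc₃, hc₄, Finset.prod_mul_distrib]
          ring
  calc _ ≤ ∫⁻ l in O ∩ {l | x ≤ ∑ i, 1 / (c₁ ^ 2 + 1 / (τ * l i))}, (ENNReal.ofReal c₃ *
        ENNReal.ofReal (∏ i, pr (l i) * φ (l i)) + ENNReal.ofReal c₄ * ENNReal.ofReal (G l)) :=
        setLIntegral_mono (by fun_prop) hpt
    _ ≤ ∫⁻ l in O, (ENNReal.ofReal c₃ *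
        ENNReal.ofReal (∏ i, pr (l i) * φ (l i)) + ENNReal.ofReal c₄ * ENNReal.ofReal (G l)) :=
        lintegral_mono_set Set.inter_subset_left
    _ = ENNReal.ofReal c₃ * ENNReal.ofReal ((1 + 2 * θ * τ * μ) ^ n) +
        ENNReal.ofReal c₄ * ∫⁻ l in O, ENNReal.ofReal (G l) := by
        rw [lintegral_add_left (by fun_prop), lintegral_const_mul _ (by fun_prop), hΦ,
          lintegral_const_mul _ (by fun_prop)]
    _ ≤ _ := by
        rw [← ENNReal.ofReal_mul (by positivity), ENNReal.ofReal_mul (p := c₄) (by positivity)]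
        gcongr
        rw [sub_eq_add_neg, Real.exp_add, mul_comm, Real.exp_nat_mul]
        gcongr
        linarith [Real.add_one_le_exp (2 * θ * τ * μ)]

theorem trueDens_eq (M : Model) (n : ℕ) (Y : Fin n → ℝ) :
    M.trueDens n Y = (√(2 * Real.pi * M.σ0sq) ^ n)⁻¹ *
      Real.exp (-(sqnorm (Y - M.K n *ᵥ M.β0 n) / (2 * M.σ0sq))) := by
  have hσ := M.hσ0
  have hpi := Real.pi_pos
  unfold Model.trueDens
  rw [neg_div, neg_div, Real.rpow_neg (by positivity), Real.sqrt_eq_rpow, ← Real.rpow_natCast,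
    ← Real.rpow_mul (by positivity)]
  congr 4
  ring

theorem trueDens_nonneg (M : Model) (n : ℕ) (Y : Fin n → ℝ) : 0 ≤ M.trueDens n Y := by
  rw [trueDens_eq]; positivity

theorem measurable_trueDens (M : Model) (n : ℕ) : Measurable (M.trueDens n) := by
  have := (@continuous_sqnorm n).measurable
  unfold Model.trueDens
  fun_prop

theorem lintegral_trueDens_mul_exp (M : Model) (n : ℕ) (t : Fin n → ℝ) :
    ∫⁻ Y, ENNReal.ofReal (Real.exp (t ⬝ᵥ (Y - M.K n *ᵥ M.β0 n)) * M.trueDens n Y)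
      = ENNReal.ofReal (Real.exp (M.σ0sq * sqnorm t / 2)) := by
  have hσ := M.hσ0
  have hpi := Real.pi_pos
  have hpos : 0 < √(2 * Real.pi * M.σ0sq) ^ n := pow_pos (Real.sqrt_pos.2 (by positivity)) n
  have h1 : ∀ Y, ENNReal.ofReal (Real.exp (t ⬝ᵥ (Y - M.K n *ᵥ M.β0 n)) * M.trueDens n Y)
      = ENNReal.ofReal ((√(2 * Real.pi * M.σ0sq) ^ n)⁻¹) *
        ENNReal.ofReal (Real.exp (t ⬝ᵥ (Y - M.K n *ᵥ M.β0 n)) *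
          Real.exp (-(sqnorm (Y - M.K n *ᵥ M.β0 n) / (2 * M.σ0sq)))) := fun Y => by
    rw [← ENNReal.ofReal_mul (by positivity), trueDens_eq]
    congr 1; ring
  simp_rw [h1]
  rw [lintegral_const_mul' _ _ ENNReal.ofReal_ne_top, lintegral_gaussian_mgf hσ,
    ← ENNReal.ofReal_mul (by positivity)]
  congr 1
  field_simp

theorem lintegral_trueDens (M : Model) (n : ℕ) :
    ∫⁻ Y, ENNReal.ofReal (M.trueDens n Y) = 1 := by
  have h := lintegral_trueDens_mul_exp M n 0
  simpa [sqnorm] using h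

theorem lintegral_trueDens_tail_le (M : Model) (n : ℕ) (t : Fin n → ℝ) {B k : ℝ} (hB : 0 < B)
    (ht : sqnorm t ≤ B) (hk : 0 ≤ k) :
    ∫⁻ Y in {Y | k < t ⬝ᵥ (Y - M.K n *ᵥ M.β0 n)}, ENNReal.ofReal (M.trueDens n Y)
      ≤ ENNReal.ofReal (Real.exp (-(k ^ 2 / (2 * M.σ0sq * B)))) := by
  have hσ := M.hσ0
  set c := k / (M.σ0sq * B) with hc
  have hc0 : 0 ≤ c := by positivity
  have htd := measurable_trueDens M n
  have hdm : Measurable fun Y : Fin n → ℝ => (c • t) ⬝ᵥ (Y - M.K n *ᵥ M.β0 n) := by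
    unfold dotProduct; fun_prop
  calc ∫⁻ Y in {Y | k < t ⬝ᵥ (Y - M.K n *ᵥ M.β0 n)}, ENNReal.ofReal (M.trueDens n Y)
      ≤ ∫⁻ Y in {Y | k < t ⬝ᵥ (Y - M.K n *ᵥ M.β0 n)}, ENNReal.ofReal (Real.exp (-(c * k))) *
          ENNReal.ofReal (Real.exp ((c • t) ⬝ᵥ (Y - M.K n *ᵥ M.β0 n)) * M.trueDens n Y) := by
        refine setLIntegral_mono (by fun_prop) fun Y hY => ?_
        rw [← ENNReal.ofReal_mul (Real.exp_pos _).le, ← mul_assoc, ← Real.exp_add]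
        refine ENNReal.ofReal_le_ofReal (le_mul_of_one_le_left (trueDens_nonneg M n Y) ?_)
        refine Real.one_le_exp ?_
        rw [smul_dotProduct, smul_eq_mul]
        have : k < t ⬝ᵥ (Y - M.K n *ᵥ M.β0 n) := hY
        nlinarith
    _ ≤ ∫⁻ Y, ENNReal.ofReal (Real.exp (-(c * k))) *
          ENNReal.ofReal (Real.exp ((c • t) ⬝ᵥ (Y - M.K n *ᵥ M.β0 n)) * M.trueDens n Y) :=
        setLIntegral_le_lintegral _ _
    _ = ENNReal.ofReal (Real.exp (-(c * k)) * Real.exp (M.σ0sq * sqnorm (c • t) / 2)) := by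
        rw [lintegral_const_mul' _ _ ENNReal.ofReal_ne_top, lintegral_trueDens_mul_exp,
          ← ENNReal.ofReal_mul (Real.exp_pos _).le]
    _ ≤ _ := by
        refine ENNReal.ofReal_le_ofReal ?_
        rw [← Real.exp_add, sqnorm_smul]
        refine Real.exp_le_exp.2 ?_
        have h1 : M.σ0sq * (c ^ 2 * sqnorm t) / 2 ≤ M.σ0sq * (c ^ 2 * B) / 2 := by gcongr
        have h2 : -(c * k) + M.σ0sq * (c ^ 2 * B) / 2 = -(k ^ 2 / (2 * M.σ0sq * B)) := by
          rw [hc]; field_simp; ring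
        linarith

/-- Data for which the noise is uniformly controlled. -/
def goodSet (M : Model) (n : ℕ) (L k : ℝ) : Set (Fin n → ℝ) :=
  {Y | (∀ i, (M.K n *ᵥ (Y - M.K n *ᵥ M.β0 n)) i ^ 2 ≤ L) ∧
    (M.K n *ᵥ M.β0 n) ⬝ᵥ (Y - M.K n *ᵥ M.β0 n) ≤ k}

theorem measurableSet_goodSet (M : Model) (n : ℕ) (L k : ℝ) :
    MeasurableSet (goodSet M n L k) := by
  have h1 : IsClosed (goodSet M n L k) := by
    have : goodSet M n L k = (⋂ i, {Y | (M.K n *ᵥ (Y - M.K n *ᵥ M.β0 n)) i ^ 2 ≤ L}) ∩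
        {Y | (M.K n *ᵥ M.β0 n) ⬝ᵥ (Y - M.K n *ᵥ M.β0 n) ≤ k} := by
      ext Y; simp [goodSet]
    rw [this]
    refine (isClosed_iInter fun i => isClosed_le ?_ continuous_const).inter
      (isClosed_le ?_ continuous_const)
    · simp only [mulVec, dotProduct]; fun_prop
    · simp only [dotProduct]; fun_prop
  exact h1.measurableSet

theorem lintegral_trueDens_goodSet_compl_le (M : Model) (n : ℕ) {c₂ b L k : ℝ} (hc₂ : 0 < c₂)
    (hup : ∀ v, sqnorm (M.K n *ᵥ v) ≤ c₂ ^ 2 * sqnorm v) (hb : 0 < b)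
    (hβ : sqnorm (M.K n *ᵥ M.β0 n) ≤ b) (hL : 0 ≤ L) (hk : 0 ≤ k) :
    ∫⁻ Y in (goodSet M n L k)ᶜ, ENNReal.ofReal (M.trueDens n Y)
      ≤ ENNReal.ofReal (2 * n * Real.exp (-(L / (2 * M.σ0sq * c₂ ^ 2))) +
          Real.exp (-(k ^ 2 / (2 * M.σ0sq * b)))) := by
  set ε : (Fin n → ℝ) → (Fin n → ℝ) := fun Y => Y - M.K n *ᵥ M.β0 n with hε
  have hsub : (goodSet M n L k)ᶜ ⊆ (⋃ i : Fin n, ({Y | √L < (M.K n i) ⬝ᵥ ε Y} ∪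
      {Y | √L < (-M.K n i) ⬝ᵥ ε Y})) ∪ {Y | k < (M.K n *ᵥ M.β0 n) ⬝ᵥ ε Y} := by
    intro Y hY
    by_contra hcon
    simp only [Set.mem_union, Set.mem_iUnion, Set.mem_ofPred_eq, not_or, not_exists, not_lt,
      neg_dotProduct] at hcon
    refine hY ⟨fun i => ?_, hcon.2⟩
    have h := hcon.1 i
    exact (Real.sq_le hL).2 ⟨by linarith [h.2, show (M.K n *ᵥ ε Y) i = M.K n i ⬝ᵥ ε Y from rfl],
      by linarith [h.1, show (M.K n *ᵥ ε Y) i = M.K n i ⬝ᵥ ε Y from rfl]⟩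
  have hrow : ∀ i, sqnorm (M.K n i) ≤ c₂ ^ 2 := fun i => by
    have h := hup (Pi.single i 1)
    have h1 : M.K n *ᵥ Pi.single i 1 = M.K n i := by
      ext j
      rw [mulVec_single_one, col_apply]
      exact (congrFun (congrFun (M.hK n).isHermitian i) j)
    have h2 : sqnorm (Pi.single i (1 : ℝ) : Fin n → ℝ) = 1 := by simp [sqnorm]
    rwa [h1, h2, mul_one] at h
  have htail : ∀ (i : Fin n) (t : Fin n → ℝ), sqnorm t = sqnorm (M.K n i) →
      ∫⁻ Y in {Y | √L < t ⬝ᵥ ε Y}, ENNReal.ofReal (M.trueDens n Y)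
      ≤ ENNReal.ofReal (Real.exp (-(L / (2 * M.σ0sq * c₂ ^ 2)))) := fun i t ht => by
    have h := lintegral_trueDens_tail_le M n t (pow_pos hc₂ 2) (ht.le.trans (hrow i))
      (Real.sqrt_nonneg L)
    rwa [Real.sq_sqrt hL] at h
  set F : (Fin n → ℝ) → ℝ≥0∞ := fun Y => ENNReal.ofReal (M.trueDens n Y)
  set e := Real.exp (-(L / (2 * M.σ0sq * c₂ ^ 2)))
  calc ∫⁻ Y in (goodSet M n L k)ᶜ, F Y
      ≤ (∑ i : Fin n, ∫⁻ Y in {Y | √L < (M.K n i) ⬝ᵥ ε Y} ∪ {Y | √L < (-M.K n i) ⬝ᵥ ε Y}, F Y) +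
          ∫⁻ Y in {Y | k < (M.K n *ᵥ M.β0 n) ⬝ᵥ ε Y}, F Y := by
        refine (lintegral_mono_set hsub).trans ((lintegral_union_le _ _ _).trans ?_)
        gcongr
        refine (lintegral_iUnion_le _ _).trans_eq (tsum_fintype _)
    _ ≤ (∑ _i : Fin n, (ENNReal.ofReal e + ENNReal.ofReal e)) +
          ENNReal.ofReal (Real.exp (-(k ^ 2 / (2 * M.σ0sq * b)))) := by
        gcongr with i
        · refine (lintegral_union_le _ _ _).trans (add_le_add (htail i _ rfl) (htail i _ ?_))
          simp [sqnorm]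
        · exact lintegral_trueDens_tail_le M n _ hb hβ hk
    _ = _ := by
        rw [← ENNReal.ofReal_add (Real.exp_pos _).le (Real.exp_pos _).le, Finset.sum_const,
          Finset.card_univ, Fintype.card_fin, nsmul_eq_mul, ← ENNReal.ofReal_natCast,
          ← ENNReal.ofReal_mul (by positivity), ← ENNReal.ofReal_add (by positivity) (by positivity)]
        congr 1; ring

theorem measurable_jd {M : Model} (hM : Measurable M.pr) (n : ℕ) (Y : Fin n → ℝ) :
    Measurable fun p : (Fin n → ℝ) × ℝ × (Fin n → ℝ) => M.jd n Y p.1 p.2.1 p.2.2 := by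
  have h : Measurable fun p : (Fin n → ℝ) × ℝ × (Fin n → ℝ) =>
      sqnorm (Y - M.K n *ᵥ p.1) := by
    have : Continuous fun p : (Fin n → ℝ) × ℝ × (Fin n → ℝ) => sqnorm (Y - M.K n *ᵥ p.1) := by
      have := @continuous_sqnorm n
      fun_prop
    exact this.measurable
  unfold Model.jd
  fun_prop

/-- The unnormalized marginal likelihood of the data. -/
def marginal (M : Model) (n : ℕ) (Y : Fin n → ℝ) : ℝ≥0∞ :=
  ∫⁻ v, ENNReal.ofReal (hyperWeight M n v) * lik M n Y v ∂hyperMeasure n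

theorem lintegral_jd {M : Model} (hM : Measurable M.pr) (n : ℕ) (Y : Fin n → ℝ)
    {E : Set (Fin n → ℝ)} (hE : MeasurableSet E) :
    ∫⁻ p in Model.posSet n ∩ {p | p.1 ∈ E}, ENNReal.ofReal (M.jd n Y p.1 p.2.1 p.2.2)
      = ∫⁻ v, ENNReal.ofReal (hyperWeight M n v) *
          (∫⁻ β in E, ENNReal.ofReal (gaussFactor M n Y β v)) ∂hyperMeasure n := by
  have hE' : MeasurableSet {p : (Fin n → ℝ) × ℝ × (Fin n → ℝ) | p.1 ∈ E} := measurable_fst hE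
  have hjm := (measurable_jd hM n Y).ennreal_ofReal
  rw [Set.inter_comm, ← Measure.restrict_restrict hE', ← lintegral_indicator hE',
    lintegral_posSet _ (hjm.indicator hE')]
  refine lintegral_congr_ae ?_
  filter_upwards [ae_hyperMeasure n] with v hv
  have hm : Measurable fun β => ENNReal.ofReal (gaussFactor M n Y β v) :=
    ((measurable_gaussFactor M n).comp (by fun_prop :
      Measurable fun β : Fin n → ℝ => (Y, β, v))).ennreal_ofReal
  rw [← lintegral_indicator hE, ← lintegral_const_mul _ (hm.indicator hE)]
  refine lintegral_congr fun β => ?_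
  by_cases hβ : β ∈ E
  · rw [Set.indicator_of_mem (by exact hβ), Set.indicator_of_mem hβ, jd_eq M n Y β hv.1 hv.2,
      ENNReal.ofReal_mul (hyperWeight_nonneg M n hv.1)]
  · rw [Set.indicator_of_notMem (by exact hβ), Set.indicator_of_notMem hβ, mul_zero]

/-- The posterior probability as a quotient of lower integrals. -/
theorem enorm_postProb_le {M : Model} (hM : Measurable M.pr) (n : ℕ) (Y : Fin n → ℝ)
    {E : Set (Fin n → ℝ)} (hE : MeasurableSet E) :
    ‖M.postProb n Y E‖ₑ ≤ (∫⁻ v, ENNReal.ofReal (hyperWeight M n v) *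
          (∫⁻ β in E, ENNReal.ofReal (gaussFactor M n Y β v)) ∂hyperMeasure n) / marginal M n Y ∧
      (marginal M n Y = ∞ → M.postProb n Y E = 0) := by
  have hjm := measurable_jd hM n Y
  have hnn : ∀ p ∈ Model.posSet n, 0 ≤ M.jd n Y p.1 p.2.1 p.2.2 := fun p hp => by
    rw [jd_eq M n Y p.1 hp.1 hp.2]
    exact mul_nonneg (hyperWeight_nonneg M n hp.1) (Real.exp_pos _).le
  have hmarg : ∫⁻ p in Model.posSet n, ENNReal.ofReal (M.jd n Y p.1 p.2.1 p.2.2)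
      = marginal M n Y := by
    have h := lintegral_jd hM n Y MeasurableSet.univ
    simpa only [Set.mem_univ, Set.ofPred_true, Set.inter_univ, Measure.restrict_univ, marginal,
      lik] using h
  have hZ : M.Z n Y = (marginal M n Y).toReal := by
    rw [Model.Z, integral_eq_lintegral_of_nonneg_ae
      ((ae_restrict_mem (measurableSet_posSet n)).mono hnn) hjm.aestronglyMeasurable, hmarg]
  have hE' : MeasurableSet {p : (Fin n → ℝ) × ℝ × (Fin n → ℝ) | p.1 ∈ E} := measurable_fst hE
  have hN : ∫ p in Model.posSet n ∩ {p | p.1 ∈ E}, M.jd n Y p.1 p.2.1 p.2.2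
      = (∫⁻ v, ENNReal.ofReal (hyperWeight M n v) *
          (∫⁻ β in E, ENNReal.ofReal (gaussFactor M n Y β v)) ∂hyperMeasure n).toReal := by
    rw [integral_eq_lintegral_of_nonneg_ae
      ((ae_restrict_mem ((measurableSet_posSet n).inter hE')).mono fun p hp => hnn p hp.1)
      hjm.aestronglyMeasurable, lintegral_jd hM n Y hE]
  refine ⟨?_, fun h => by rw [Model.postProb, hZ, h, ENNReal.toReal_top, div_zero]⟩
  rw [Model.postProb, hN, hZ, ← ENNReal.toReal_div, Real.enorm_of_nonneg ENNReal.toReal_nonneg]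
  exact ENNReal.ofReal_toReal_le

/-- Hyperparameters with large effective dimension. -/
def largeDim (M : Model) (n : ℕ) (c₁ x : ℝ) : Set (ℝ × (Fin n → ℝ)) :=
  {v | x ≤ ∑ i, 1 / (c₁ ^ 2 + 1 / (M.τsq n * v.2 i))}

theorem measurableSet_largeDim (M : Model) (n : ℕ) (c₁ x : ℝ) :
    MeasurableSet (largeDim M n c₁ x) :=
  measurableSet_le measurable_const (by fun_prop)

theorem measurable_sqnorm_mulVec {n : ℕ} (A : Matrix (Fin n) (Fin n) ℝ) :
    Measurable fun β : Fin n → ℝ => sqnorm (A *ᵥ β) := by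
  have : Continuous fun β : Fin n → ℝ => sqnorm (A *ᵥ β) := by
    have := @continuous_sqnorm n
    fun_prop
  exact this.measurable

theorem measurable_gaussFactor_coef (M : Model) (n : ℕ) (Y : Fin n → ℝ) (v : ℝ × (Fin n → ℝ)) :
    Measurable fun β => gaussFactor M n Y β v := by
  have h : Measurable fun β : Fin n → ℝ => sqnorm (Y - M.K n *ᵥ β) := by
    have : Continuous fun β : Fin n → ℝ => sqnorm (Y - M.K n *ᵥ β) := by
      have := @continuous_sqnorm n
      fun_prop
    exact this.measurable
  unfold gaussFactor; fun_prop

theorem lintegral_hyperWeight_mul_le {M : Model} {n : ℕ} (hM : Measurable M.pr)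
    (hτ : 0 < M.τsq n) {c₁ c₂ : ℝ} (hc₁ : 0 < c₁)
    (hlow : ∀ v, c₁ ^ 2 * sqnorm v ≤ sqnorm (M.K n *ᵥ v))
    (hup : ∀ v, sqnorm (M.K n *ᵥ v) ≤ c₂ ^ 2 * sqnorm v) {b L k x S H : ℝ}
    (hβ : sqnorm (M.K n *ᵥ M.β0 n) ≤ b) (hL : 0 ≤ L) (hS : 0 ≤ S) (hH : 0 < H)
    (hbH : 4 * b ≤ H) {Y : Fin n → ℝ} (hY : Y ∈ goodSet M n L k) :
    ∫⁻ v, ENNReal.ofReal (hyperWeight M n v) *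
        (∫⁻ β in {β | H ≤ sqnorm (M.K n *ᵥ β - M.K n *ᵥ M.β0 n)},
          ENNReal.ofReal (gaussFactor M n Y β v)) ∂hyperMeasure n
      ≤ (∫⁻ v in largeDim M n c₁ x, ENNReal.ofReal (hyperWeight M n v) * lik M n Y v
            ∂hyperMeasure n) +
        (∫⁻ v in {v | S ≤ v.1}, ENNReal.ofReal (hyperWeight M n v) * lik M n Y v
            ∂hyperMeasure n) +
        ENNReal.ofReal ((4 * b + 4 * (L * x) + 16 * (c₂ ^ 2 * S * x)) / (H / 4)) *
          marginal M n Y := by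
  set D₁ := largeDim M n c₁ x with hD₁
  set D₂ : Set (ℝ × (Fin n → ℝ)) := {v | S ≤ v.1}
  have hmD₁ : MeasurableSet D₁ := measurableSet_largeDim M n c₁ x
  have hmD₂ : MeasurableSet D₂ := measurableSet_le measurable_const measurable_fst
  set W : ℝ × (Fin n → ℝ) → ℝ≥0∞ := fun v => ENNReal.ofReal (hyperWeight M n v) * lik M n Y v
    with hW
  have hWm : Measurable W :=
    (measurable_hyperWeight hM n).ennreal_ofReal.mul ((measurable_lik M n).of_uncurry_left)
  set δ := (4 * b + 4 * (L * x) + 16 * (c₂ ^ 2 * S * x)) / (H / 4) with hδ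
  have hpt : ∀ᵐ v ∂hyperMeasure n, ENNReal.ofReal (hyperWeight M n v) *
        (∫⁻ β in {β | H ≤ sqnorm (M.K n *ᵥ β - M.K n *ᵥ M.β0 n)},
          ENNReal.ofReal (gaussFactor M n Y β v))
      ≤ D₁.indicator W v + D₂.indicator W v + ENNReal.ofReal δ * W v := by
    filter_upwards [ae_hyperMeasure n] with v hv
    by_cases h1 : v ∈ D₁
    · rw [Set.indicator_of_mem h1, add_assoc]
      exact le_add_right (mul_le_mul_right (setLIntegral_le_lintegral _ _) _)
    by_cases h2 : v ∈ D₂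
    · rw [Set.indicator_of_mem h2, add_comm (D₁.indicator W v), add_assoc]
      exact le_add_right (mul_le_mul_right (setLIntegral_le_lintegral _ _) _)
    refine le_add_left ?_
    rw [hW, mul_left_comm]
    refine mul_le_mul_right ?_ _
    have h1' : ∑ i, 1 / (c₁ ^ 2 + 1 / (M.τsq n * v.2 i)) ≤ x := (not_le.1 h1).le
    have h2' : v.1 ≤ S := (not_le.1 h2).le
    have hsum0 : 0 ≤ ∑ i, 1 / (c₁ ^ 2 + 1 / (M.τsq n * v.2 i)) :=
      Finset.sum_nonneg fun i _ => by have := hv.2 i; positivity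
    have hfit := lintegral_sqnorm_fit_le (M.hK n).isHermitian hc₁ hlow hup
      (e := fun i => 1 / (M.τsq n * v.2 i)) (fun i => by have := hv.2 i; positivity)
      Y (M.β0 n) hY.1 hv.1
    have hmg := measurable_gaussFactor_coef M n Y v
    have hms := measurable_sqnorm_mulVec (M.K n)
    calc ∫⁻ β in {β | H ≤ sqnorm (M.K n *ᵥ β - M.K n *ᵥ M.β0 n)},
          ENNReal.ofReal (gaussFactor M n Y β v)
        ≤ ∫⁻ β in {β | H ≤ sqnorm (M.K n *ᵥ β - M.K n *ᵥ M.β0 n)},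
          ENNReal.ofReal (4 / H) *
            ENNReal.ofReal (sqnorm (M.K n *ᵥ β) * gaussFactor M n Y β v) := by
          refine setLIntegral_mono (by fun_prop) fun β hβE => ?_
          have hβE' : H ≤ sqnorm (M.K n *ᵥ β - M.K n *ᵥ M.β0 n) := hβE
          rw [← ENNReal.ofReal_mul (by positivity), ← mul_assoc]
          refine ENNReal.ofReal_le_ofReal (le_mul_of_one_le_left (Real.exp_pos _).le ?_)
          have h3 := sqnorm_add_le (M.K n *ᵥ β) ((-1 : ℝ) • M.K n *ᵥ M.β0 n)
          rw [sqnorm_smul, neg_one_smul, ← sub_eq_add_neg] at h3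
          rw [div_mul_eq_mul_div, one_le_div hH]
          linarith
      _ ≤ ENNReal.ofReal (4 / H) *
            ∫⁻ β, ENNReal.ofReal (sqnorm (M.K n *ᵥ β) * gaussFactor M n Y β v) := by
          rw [← lintegral_const_mul' _ _ ENNReal.ofReal_ne_top]
          exact setLIntegral_le_lintegral _ _
      _ ≤ ENNReal.ofReal (4 / H) * (ENNReal.ofReal (4 * b + 4 * (L * x) +
            16 * (c₂ ^ 2 * S * x)) * lik M n Y v) := by
          refine mul_le_mul_right (hfit.trans (mul_le_mul_left (ENNReal.ofReal_le_ofReal ?_) _)) _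
          have := hv.1.le
          gcongr
      _ = _ := by
          rw [← mul_assoc, ← ENNReal.ofReal_mul (by positivity), hδ]
          congr 2
          field_simp
  refine (lintegral_mono_ae hpt).trans_eq ?_
  rw [lintegral_add_right _ (hWm.const_mul _),
    lintegral_add_left (hWm.indicator hmD₁), lintegral_indicator hmD₁, lintegral_indicator hmD₂,
    lintegral_const_mul _ hWm]
  rfl

/-- The factor comparing the true density with the marginal likelihood. -/
def evidenceFactor (M : Model) (n : ℕ) (c₂ b k : ℝ) : ℝ :=
  n / (M.σ0sq * ((2 * M.σ0sq) ^ (-M.a / 2 - 1) * Real.exp (-M.b / (2 * M.σ0sq)) *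
      Real.exp (-(1 / 2)))) *
    Real.exp ((2 * k + b) / (2 * M.σ0sq)) *
    Real.exp (n * (c₂ ^ 2 * M.τsq n * (∫ x in Set.Ioi (0 : ℝ), x * M.pr x) / 2))

theorem evidenceFactor_nonneg (M : Model) (n : ℕ) (c₂ b k : ℝ) :
    0 ≤ evidenceFactor M n c₂ b k := by
  have := M.hσ0
  unfold evidenceFactor; positivity

theorem trueDens_le_marginal {M : Model} (hM : Measurable M.pr) {n : ℕ} (hn : 0 < n)
    (hτ : 0 < M.τsq n) {c₂ : ℝ} (hup : ∀ v, sqnorm (M.K n *ᵥ v) ≤ c₂ ^ 2 * sqnorm v)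
    (hint : IntegrableOn M.pr (Set.Ioi 0))
    (hint1 : IntegrableOn (fun x => x * M.pr x) (Set.Ioi 0)) {b L k : ℝ}
    (hβ : sqnorm (M.K n *ᵥ M.β0 n) ≤ b) {Y : Fin n → ℝ} (hY : Y ∈ goodSet M n L k) :
    ENNReal.ofReal (M.trueDens n Y) ≤
      ENNReal.ofReal ((√(2 * Real.pi) ^ n)⁻¹ * (√(2 * Real.pi * M.τsq n) ^ n)⁻¹ *
        evidenceFactor M n c₂ b k) * marginal M n Y := by
  have hσ := M.hσ0
  have hpi := Real.pi_pos
  have hn' : (0 : ℝ) < n := by exact_mod_cast hn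
  have hA := evidenceFactor_nonneg M n c₂ b k
  refine le_trans ?_ (mul_le_mul_right (le_marginal hM hn hτ hup hint hint1 Y hσ) _)
  rw [← ENNReal.ofReal_mul (by positivity), trueDens_eq]
  refine ENNReal.ofReal_le_ofReal ?_
  have hsq : sqnorm Y = sqnorm (M.K n *ᵥ M.β0 n) +
      2 * ((M.K n *ᵥ M.β0 n) ⬝ᵥ (Y - M.K n *ᵥ M.β0 n)) + sqnorm (Y - M.K n *ᵥ M.β0 n) := by
    rw [← sqnorm_add, add_sub_cancel]
  have hexp : Real.exp (-(sqnorm (Y - M.K n *ᵥ M.β0 n) / (2 * M.σ0sq))) ≤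
      Real.exp ((2 * k + b) / (2 * M.σ0sq)) * Real.exp (-(sqnorm Y / (2 * M.σ0sq))) := by
    rw [← Real.exp_add, ← neg_div, ← neg_div, ← add_div]
    refine Real.exp_le_exp.2 (div_le_div_of_nonneg_right ?_ (by positivity))
    have := hY.2
    linarith
  have h1 : √(2 * Real.pi * M.σ0sq) ^ n = √(2 * Real.pi) ^ n * √M.σ0sq ^ n := by
    rw [Real.sqrt_mul (by positivity), mul_pow]
  rw [h1]
  have hp1 : 0 < √(2 * Real.pi) ^ n := pow_pos (Real.sqrt_pos.2 (by positivity)) n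
  have hp2 : 0 < √(2 * Real.pi * M.τsq n) ^ n := pow_pos (Real.sqrt_pos.2 (by positivity)) n
  have hp3 : 0 < √M.σ0sq ^ n := pow_pos (Real.sqrt_pos.2 hσ) n
  have hg : 0 < (2 * M.σ0sq) ^ (-M.a / 2 - 1) := Real.rpow_pos_of_pos (by positivity) _
  refine (mul_le_mul_of_nonneg_left hexp (by positivity)).trans_eq ?_
  rw [evidenceFactor, Real.exp_neg (n * _)]
  have he := Real.exp_pos (n * (c₂ ^ 2 * M.τsq n * (∫ x in Set.Ioi (0 : ℝ), x * M.pr x) / 2))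
  field_simp

theorem sqnorm_le_of_mem_goodSet {M : Model} {n : ℕ} {c₁ c₂ : ℝ} (hc₁ : 0 < c₁)
    (hlow : ∀ v, c₁ ^ 2 * sqnorm v ≤ sqnorm (M.K n *ᵥ v))
    (hup : ∀ v, sqnorm (M.K n *ᵥ v) ≤ c₂ ^ 2 * sqnorm v) {b L k : ℝ}
    (hβ : sqnorm (M.K n *ᵥ M.β0 n) ≤ b) {Y : Fin n → ℝ} (hY : Y ∈ goodSet M n L k) :
    sqnorm Y ≤ (2 * (c₂ ^ 2 * b) + 2 * (n * L)) / c₁ ^ 2 := by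
  rw [le_div_iff₀ (by positivity), mul_comm]
  refine (hlow Y).trans ?_
  have h1 : M.K n *ᵥ Y = M.K n *ᵥ (M.K n *ᵥ M.β0 n) + M.K n *ᵥ (Y - M.K n *ᵥ M.β0 n) := by
    rw [← mulVec_add, add_sub_cancel]
  have h2 : sqnorm (M.K n *ᵥ (Y - M.K n *ᵥ M.β0 n)) ≤ n * L := by
    rw [sqnorm_eq_sum]
    refine (Finset.sum_le_sum fun i _ => hY.1 i).trans_eq ?_
    simp
  have h3 := hup (M.K n *ᵥ M.β0 n)
  have h4 : c₂ ^ 2 * sqnorm (M.K n *ᵥ M.β0 n) ≤ c₂ ^ 2 * b := by gcongr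
  rw [h1]
  refine (sqnorm_add_le _ _).trans ?_
  linarith

theorem lintegral_gaussian_le_all {n : ℕ} (Ω : Set (Fin n → ℝ)) {s : ℝ} (hs : 0 < s)
    (m : Fin n → ℝ) :
    ∫⁻ Y in Ω, ENNReal.ofReal (Real.exp (-(sqnorm (Y - m) / (2 * s))))
      ≤ ENNReal.ofReal (√(2 * Real.pi) ^ n) * ENNReal.ofReal (√s ^ n) := by
  refine (setLIntegral_le_lintegral _ _).trans_eq ?_
  have hpi := Real.pi_pos
  rw [lintegral_gaussian_sqnorm hs, Real.sqrt_mul (by positivity), mul_pow,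
    ENNReal.ofReal_mul (by positivity)]

theorem lintegral_gaussian_le_of_sqnorm_le {n : ℕ} {Ω : Set (Fin n → ℝ)} {R r S s : ℝ}
    (hΩ : ∀ Y ∈ Ω, sqnorm Y ≤ R) (hr : 0 < r) (hS : 0 < S) (hs : S ≤ s) (m : Fin n → ℝ) :
    ∫⁻ Y in Ω, ENNReal.ofReal (Real.exp (-(sqnorm (Y - m) / (2 * s))))
      ≤ ENNReal.ofReal (√(2 * Real.pi) ^ n * ((√r / √S) ^ n * Real.exp (R / (2 * r)))) *
        ENNReal.ofReal (√s ^ n) := by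
  have hpi := Real.pi_pos
  have hs0 := hS.trans_le hs
  have hm : Measurable (sqnorm : (Fin n → ℝ) → ℝ) := continuous_sqnorm.measurable
  calc ∫⁻ Y in Ω, ENNReal.ofReal (Real.exp (-(sqnorm (Y - m) / (2 * s))))
      ≤ ∫⁻ Y in Ω, ENNReal.ofReal (Real.exp (R / (2 * r))) *
          ENNReal.ofReal (Real.exp (-(sqnorm (Y - 0) / (2 * r)))) := by
        refine setLIntegral_mono (by fun_prop) fun Y hY => ?_
        rw [← ENNReal.ofReal_mul (Real.exp_pos _).le, ← Real.exp_add, sub_zero]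
        refine ENNReal.ofReal_le_ofReal (Real.exp_le_exp.2 ?_)
        have h1 : 0 ≤ sqnorm (Y - m) / (2 * s) := div_nonneg (sqnorm_nonneg _) (by positivity)
        have h2 : sqnorm Y / (2 * r) ≤ R / (2 * r) :=
          div_le_div_of_nonneg_right (hΩ Y hY) (by positivity)
        linarith
    _ ≤ ENNReal.ofReal (Real.exp (R / (2 * r))) * ENNReal.ofReal (√(2 * Real.pi * r) ^ n) := by
        rw [lintegral_const_mul' _ _ ENNReal.ofReal_ne_top, ← lintegral_gaussian_sqnorm hr 0]
        exact mul_le_mul_right (setLIntegral_le_lintegral _ _) _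
    _ ≤ _ := by
        rw [← ENNReal.ofReal_mul (Real.exp_pos _).le, ← ENNReal.ofReal_mul (by positivity)]
        refine ENNReal.ofReal_le_ofReal ?_
        have h1 : 1 ≤ (√s / √S) ^ n :=
          one_le_pow₀ ((one_le_div (Real.sqrt_pos.2 hS)).2 (Real.sqrt_le_sqrt hs))
        rw [Real.sqrt_mul (by positivity)]
        calc Real.exp (R / (2 * r)) * (√(2 * Real.pi) * √r) ^ n
            ≤ Real.exp (R / (2 * r)) * (√(2 * Real.pi) * √r) ^ n * (√s / √S) ^ n :=
              le_mul_of_one_le_right (by positivity) h1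
          _ = _ := by rw [div_pow, div_pow, mul_pow]; field_simp

theorem lintegral_prior_le_one {pr : ℝ → ℝ} (hpr : Measurable pr) (h0 : ∀ x, 0 ≤ pr x)
    (hone : ∫ x in Set.Ioi (0 : ℝ), pr x = 1) (hint : IntegrableOn pr (Set.Ioi 0)) (n : ℕ) :
    ∫⁻ l in {l : Fin n → ℝ | ∀ i, 0 < l i}, ∏ i, ENNReal.ofReal (pr (l i)) = 1 := by
  rw [lintegral_orthant_prod (fun _ t => ENNReal.ofReal (pr t)) fun _ => hpr.ennreal_ofReal,
    ← ofReal_integral_eq_lintegral_ofReal hint (ae_of_all _ h0), hone]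
  simp

/-- Total mass of the inverse-gamma kernel. -/
def igMass (a b : ℝ) : ℝ := (∫⁻ s in Set.Ioi (0 : ℝ), ENNReal.ofReal (igKernel a b s)).toReal

theorem lintegral_igKernel_eq {a b : ℝ} (ha : 0 < a) (hb : 0 < b) :
    ∫⁻ s in Set.Ioi (0 : ℝ), ENNReal.ofReal (igKernel a b s) = ENNReal.ofReal (igMass a b) :=
  (ENNReal.ofReal_toReal (lintegral_igKernel_lt_top ha hb).ne).symm

theorem igMass_nonneg (a b : ℝ) : 0 ≤ igMass a b := ENNReal.toReal_nonneg

theorem lintegral_hyper_snd_le {M : Model} (hM : Measurable M.pr) (n : ℕ)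
    {T : Set (Fin n → ℝ)} (hT : MeasurableSet T) {t : ℝ}
    (ht : ∫⁻ l in {l : Fin n → ℝ | ∀ i, 0 < l i} ∩ T, ∏ i, ENNReal.ofReal (M.pr (l i))
      ≤ ENNReal.ofReal t) :
    ∫⁻ v in {v | v.2 ∈ T}, ENNReal.ofReal (igKernel M.a M.b v.1) *
        ∏ i, ENNReal.ofReal (M.pr (v.2 i)) ∂hyperMeasure n
      ≤ ENNReal.ofReal (igMass M.a M.b * t) := by
  have hset : {v : ℝ × (Fin n → ℝ) | v.2 ∈ T} = Set.univ ×ˢ T := by ext; simp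
  have hig := (measurable_igKernel M.a M.b).ennreal_ofReal
  have hprod : Measurable fun l : Fin n → ℝ => ∏ i, ENNReal.ofReal (M.pr (l i)) := by fun_prop
  rw [hset, hyperMeasure, ← Measure.prod_restrict, Measure.restrict_univ,
    lintegral_prod_mul hig.aemeasurable hprod.aemeasurable, Measure.restrict_restrict hT,
    lintegral_igKernel_eq M.ha M.hb, ENNReal.ofReal_mul (igMass_nonneg _ _), Set.inter_comm]
  exact mul_le_mul_right ht _

/-- Finite-sample bound on the expected posterior probability of a large prediction error. -/
theorem abs_E0_postProb_le {M : Model} {n : ℕ} (hM : Measurable M.pr) (hn : 0 < n)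
    (hτ : 0 < M.τsq n) {c₁ c₂ : ℝ} (hc₁ : 0 < c₁) (hc₂ : 0 < c₂)
    (hlow : ∀ v, c₁ ^ 2 * sqnorm v ≤ sqnorm (M.K n *ᵥ v))
    (hup : ∀ v, sqnorm (M.K n *ᵥ v) ≤ c₂ ^ 2 * sqnorm v)
    (hint : IntegrableOn M.pr (Set.Ioi 0))
    (hint1 : IntegrableOn (fun x => x * M.pr x) (Set.Ioi 0)) {b L k x S H r t : ℝ}
    (hb : 0 < b) (hβ : sqnorm (M.K n *ᵥ M.β0 n) ≤ b) (hL : 0 ≤ L) (hk : 0 ≤ k) (hx : 0 ≤ x)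
    (hS : 0 < S) (hr : 0 < r) (hH : 0 < H) (hbH : 4 * b ≤ H) (ht0 : 0 ≤ t)
    (ht : ∫⁻ l in {l : Fin n → ℝ | ∀ i, 0 < l i} ∩
        {l | x ≤ ∑ i, 1 / (c₁ ^ 2 + 1 / (M.τsq n * l i))}, ∏ i, ENNReal.ofReal (M.pr (l i))
      ≤ ENNReal.ofReal t) :
    |M.E0 n fun Y => M.postProb n Y {β | H ≤ sqnorm (M.K n *ᵥ β - M.K n *ᵥ M.β0 n)}|
      ≤ (2 * n * Real.exp (-(L / (2 * M.σ0sq * c₂ ^ 2))) +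
          Real.exp (-(k ^ 2 / (2 * M.σ0sq * b)))) +
        (evidenceFactor M n c₂ b k * (igMass M.a M.b * t) +
        evidenceFactor M n c₂ b k * ((√r / √S) ^ n *
          Real.exp ((2 * (c₂ ^ 2 * b) + 2 * (n * L)) / c₁ ^ 2 / (2 * r))) * igMass M.a M.b +
        (4 * b + 4 * (L * x) + 16 * (c₂ ^ 2 * S * x)) / (H / 4)) := by
  have hσ := M.hσ0
  have hpi := Real.pi_pos
  set A := evidenceFactor M n c₂ b k with hA
  have hA0 : 0 ≤ A := evidenceFactor_nonneg M n c₂ b k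
  set G := igMass M.a M.b with hG
  have hG0 : 0 ≤ G := igMass_nonneg _ _
  set T₁ := 2 * n * Real.exp (-(L / (2 * M.σ0sq * c₂ ^ 2))) +
          Real.exp (-(k ^ 2 / (2 * M.σ0sq * b))) with hT₁
  set κ := (√r / √S) ^ n * Real.exp ((2 * (c₂ ^ 2 * b) + 2 * (n * L)) / c₁ ^ 2 / (2 * r)) with hκ
  have hκ0 : 0 ≤ κ := by positivity
  set δ := (4 * b + 4 * (L * x) + 16 * (c₂ ^ 2 * S * x)) / (H / 4) with hδ
  have hδ0 : 0 ≤ δ := by positivity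
  set E := {β | H ≤ sqnorm (M.K n *ᵥ β - M.K n *ᵥ M.β0 n)} with hE
  have hEm : MeasurableSet E := by
    have : IsClosed E := isClosed_le continuous_const (by
      have := @continuous_sqnorm n
      fun_prop)
    exact this.measurableSet
  set Ω := goodSet M n L k with hΩ
  have hΩm : MeasurableSet Ω := measurableSet_goodSet M n L k
  set W : (Fin n → ℝ) → ℝ × (Fin n → ℝ) → ℝ≥0∞ :=
    fun Y v => ENNReal.ofReal (hyperWeight M n v) * lik M n Y v with hW
  have hWm : Measurable (Function.uncurry W) :=
    ((measurable_hyperWeight hM n).comp measurable_snd).ennreal_ofReal.mul (measurable_lik M n)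
  set B₁ : (Fin n → ℝ) → ℝ≥0∞ := fun Y => ∫⁻ v in largeDim M n c₁ x, W Y v ∂hyperMeasure n
    with hB₁
  set B₂ : (Fin n → ℝ) → ℝ≥0∞ := fun Y => ∫⁻ v in {v | S ≤ v.1}, W Y v ∂hyperMeasure n with hB₂
  have hB₁m : Measurable B₁ := hWm.lintegral_prod_right'
  have hB₂m : Measurable B₂ := hWm.lintegral_prod_right'
  set sτ := √(2 * Real.pi * M.τsq n) ^ n with hsτ
  have hsτ0 : 0 < sτ := pow_pos (Real.sqrt_pos.2 (by positivity)) n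
  set sp := √(2 * Real.pi) ^ n with hsp
  have hsp0 : 0 < sp := pow_pos (Real.sqrt_pos.2 (by positivity)) n
  set Λ := sp⁻¹ * sτ⁻¹ * A with hΛ
  have hΛ0 : 0 ≤ Λ := by positivity
  have htd := (measurable_trueDens M n).ennreal_ofReal
  have hD₂m : MeasurableSet {v : ℝ × (Fin n → ℝ) | S ≤ v.1} :=
    measurableSet_le measurable_const measurable_fst
  have hmass₁ : ∫⁻ Y in Ω, B₁ Y ≤ ENNReal.ofReal (sp * sτ * (G * t)) := by
    refine (lintegral_mass_le hM hτ (measurableSet_largeDim M n c₁ x) fun v _ hv m =>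
      lintegral_gaussian_le_all Ω hv m).trans ?_
    rw [ENNReal.ofReal_mul (q := G * t) (by positivity), ENNReal.ofReal_mul (q := sτ) hsp0.le]
    refine mul_le_mul_right ?_ _
    exact lintegral_hyper_snd_le hM n (T := {l | x ≤ ∑ i, 1 / (c₁ ^ 2 + 1 / (M.τsq n * l i))})
      (measurableSet_le measurable_const (by fun_prop)) ht
  have hmass₂ : ∫⁻ Y in Ω, B₂ Y ≤ ENNReal.ofReal (sp * κ * sτ * G) := by
    refine (lintegral_mass_le hM hτ hD₂m fun v hvS hv m =>
      lintegral_gaussian_le_of_sqnorm_le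
        (fun Y hY => sqnorm_le_of_mem_goodSet hc₁ hlow hup hβ hY) hr hS hvS m).trans ?_
    rw [ENNReal.ofReal_mul (q := G) (by positivity), ENNReal.ofReal_mul (q := sτ) (by positivity)]
    refine mul_le_mul_right ((setLIntegral_le_lintegral _ _).trans ?_) _
    have h := lintegral_hyper_snd_le hM n (T := Set.univ) MeasurableSet.univ (t := 1) (by
      rw [Set.inter_univ, lintegral_prior_le_one hM M.hpr_nonneg M.hpr_int hint,
        ENNReal.ofReal_one])
    simpa only [Set.mem_univ, Set.ofPred_true, Measure.restrict_univ, mul_one] using h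
  have hcompl : ∀ Y, ‖M.postProb n Y E * M.trueDens n Y‖ₑ ≤ ENNReal.ofReal (M.trueDens n Y) :=
    fun Y => by
      rw [enorm_mul, Real.enorm_of_nonneg (trueDens_nonneg M n Y)]
      refine mul_le_of_le_one_left zero_le ((enorm_postProb_le hM n Y hEm).1.trans ?_)
      refine (ENNReal.div_le_div_right (lintegral_mono fun v => ?_) _).trans
        ENNReal.div_self_le_one
      exact mul_le_mul_right (setLIntegral_le_lintegral _ _) _
  have hgood : ∀ Y ∈ Ω, ‖M.postProb n Y E * M.trueDens n Y‖ₑ ≤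
      ENNReal.ofReal Λ * (B₁ Y + B₂ Y) + ENNReal.ofReal δ * ENNReal.ofReal (M.trueDens n Y) :=
    fun Y hY => by
      rw [enorm_mul, Real.enorm_of_nonneg (trueDens_nonneg M n Y)]
      obtain ⟨h1, h2⟩ := enorm_postProb_le hM n Y hEm
      have hnum := lintegral_hyperWeight_mul_le (x := x) hM hτ hc₁ hlow hup hβ hL hS.le hH hbH hY
      have hev := trueDens_le_marginal hM hn hτ hup hint hint1 hβ hY
      set m := marginal M n Y
      calc ‖M.postProb n Y E‖ₑ * ENNReal.ofReal (M.trueDens n Y)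
          ≤ (B₁ Y + B₂ Y + ENNReal.ofReal δ * m) / m * ENNReal.ofReal (M.trueDens n Y) :=
            mul_le_mul_left (h1.trans (ENNReal.div_le_div_right hnum _)) _
        _ = (B₁ Y + B₂ Y) / m * ENNReal.ofReal (M.trueDens n Y) +
              ENNReal.ofReal δ * (m / m) * ENNReal.ofReal (M.trueDens n Y) := by
            rw [ENNReal.add_div, add_mul, mul_div_assoc]
        _ ≤ (B₁ Y + B₂ Y) / m * (ENNReal.ofReal Λ * m) +
              ENNReal.ofReal δ * 1 * ENNReal.ofReal (M.trueDens n Y) := by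
            gcongr
            exact ENNReal.div_self_le_one
        _ ≤ _ := by
            rw [mul_one, mul_comm (_ / m), mul_assoc]
            gcongr
            exact ENNReal.mul_div_le
  have hmain : ‖M.E0 n fun Y => M.postProb n Y E‖ₑ ≤
      ENNReal.ofReal (T₁ + (A * (G * t) + A * κ * G + δ)) := by
    refine (enorm_integral_le_lintegral_enorm _).trans ?_
    rw [← lintegral_add_compl _ hΩm, add_comm, ENNReal.ofReal_add (by positivity) (by positivity)]
    refine add_le_add ?_ ?_
    · exact (lintegral_mono fun Y => hcompl Y).trans
        (lintegral_trueDens_goodSet_compl_le M n hc₂ hup hb hβ hL hk)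
    · calc ∫⁻ Y in Ω, ‖M.postProb n Y E * M.trueDens n Y‖ₑ
          ≤ ∫⁻ Y in Ω, (ENNReal.ofReal Λ * (B₁ Y + B₂ Y) +
              ENNReal.ofReal δ * ENNReal.ofReal (M.trueDens n Y)) :=
            setLIntegral_mono' hΩm hgood
        _ = ENNReal.ofReal Λ * (∫⁻ Y in Ω, B₁ Y) + ENNReal.ofReal Λ * (∫⁻ Y in Ω, B₂ Y) +
              ENNReal.ofReal δ * ∫⁻ Y in Ω, ENNReal.ofReal (M.trueDens n Y) := by
            rw [lintegral_add_right _ (htd.const_mul _), lintegral_const_mul' _ _ ENNReal.ofReal_ne_top,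
              lintegral_const_mul _ htd, lintegral_add_left hB₁m, mul_add]
        _ ≤ ENNReal.ofReal Λ * ENNReal.ofReal (sp * sτ * (G * t)) +
              ENNReal.ofReal Λ * ENNReal.ofReal (sp * κ * sτ * G) + ENNReal.ofReal δ * 1 := by
            gcongr
            exact (setLIntegral_le_lintegral _ _).trans_eq (lintegral_trueDens M n)
        _ = _ := by
            rw [mul_one, ← ENNReal.ofReal_mul hΛ0, ← ENNReal.ofReal_mul hΛ0,
              ← ENNReal.ofReal_add (by positivity) (by positivity),
              ← ENNReal.ofReal_add (by positivity) hδ0]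
            congr 2
            rw [hΛ]
            field_simp
  rw [← Real.norm_eq_abs, ← ENNReal.ofReal_le_ofReal_iff (by positivity), ofReal_norm]
  exact hmain

theorem exp_rate_linear {ℓ D E h q e : ℝ} (hℓ : 0 < ℓ) (hE : 0 ≤ E) (hD : 0 ≤ D)
    (hh : 8 ≤ h) (hq : 1 ≤ q) (hDE : D + E ≤ ℓ / 4) (he : e ≤ E * q) :
    Real.exp ℓ * Real.exp (D * h * q) * Real.exp (e - ℓ ^ 2 * (h ^ 2 * q / ℓ) / 2)
      ≤ Real.exp (-ℓ) := by
  rw [← Real.exp_add, ← Real.exp_add]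
  refine Real.exp_le_exp.2 ?_
  have h1 : ℓ ^ 2 * (h ^ 2 * q / ℓ) / 2 = ℓ * (h ^ 2 * q) / 2 := by field_simp
  have hhq : h * q ≤ h ^ 2 * q := by nlinarith [mul_nonneg (by linarith : 0 ≤ h) (by linarith : 0 ≤ q)]
  have hq' : q ≤ h ^ 2 * q := by nlinarith
  have h8 : 8 ≤ h ^ 2 * q := by nlinarith
  have h2 : D * h * q ≤ D * (h ^ 2 * q) := by rw [mul_assoc]; gcongr
  have h3 : E * q ≤ E * (h ^ 2 * q) := by gcongr
  have h4 : (D + E) * (h ^ 2 * q) ≤ ℓ / 4 * (h ^ 2 * q) := by gcongr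
  have h5 : ℓ / 4 * 8 ≤ ℓ / 4 * (h ^ 2 * q) := by gcongr
  rw [h1]
  linarith

theorem exp_rate_quadratic {N ℓ D F h q w c : ℝ} (hℓ : 0 < ℓ) (hF : 0 ≤ F)
    (hc : 0 < c) (hh : 1 ≤ h) (hq : 1 ≤ q) (hDF : D + F + 2 ≤ h * c / 16)
    (hw : w ≤ F * q) (hNw : N * w ≤ F * q ^ 2) :
    N * Real.exp (D * h * q) * (2 * Real.exp (-(ℓ / 4 * c * (h ^ 2 * q / ℓ) / 2)) *
      (w * Real.exp w)) ≤ 2 * F * Real.exp (-(h * c / 16)) := by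
  have hq2 : q ^ 2 ≤ Real.exp (2 * q) := by
    have h1 := Real.add_one_le_exp q
    calc q ^ 2 ≤ Real.exp q ^ 2 := by gcongr; linarith
      _ = _ := by rw [← Real.exp_nat_mul]; norm_num
  have h1 : ℓ / 4 * c * (h ^ 2 * q / ℓ) / 2 = c * (h ^ 2 * q) / 8 := by field_simp; norm_num
  rw [h1]
  calc N * Real.exp (D * h * q) * (2 * Real.exp (-(c * (h ^ 2 * q) / 8)) * (w * Real.exp w))
      = (N * w) * (2 * (Real.exp (D * h * q) * Real.exp (-(c * (h ^ 2 * q) / 8)) *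
          Real.exp w)) := by ring
    _ ≤ (F * Real.exp (2 * q)) * (2 * (Real.exp (D * h * q) *
          Real.exp (-(c * (h ^ 2 * q) / 8)) * Real.exp w)) := by
        have : N * w ≤ F * Real.exp (2 * q) := hNw.trans (by gcongr)
        gcongr
    _ = 2 * F * Real.exp (2 * q + (D * h * q + -(c * (h ^ 2 * q) / 8) + w)) := by
        simp only [Real.exp_add]; ring
    _ ≤ _ := by
        gcongr
        have h2 : q ≤ h * q := by nlinarith
        have h3 : (D + F + 2) * (h * q) ≤ h * c / 16 * (h * q) := by
          gcongr
        have h4 : F * q ≤ F * (h * q) := by gcongr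
        have h5 : h ≤ h * (h * q) := by nlinarith
        have h6 : h * c / 16 ≤ h * (h * q) * c / 16 := by gcongr
        nlinarith

theorem evidenceFactor_le (M : Model) (n : ℕ) {c₂ C₁ C h q D : ℝ} (hC₁ : 0 ≤ C₁)
    (hμ : 0 ≤ ∫ x in Set.Ioi (0 : ℝ), x * M.pr x) (hC : 0 ≤ C)
    (hq : 0 ≤ q) (hh : 1 ≤ h) (hτ : n * M.τsq n ≤ C * q)
    (hD : D = (2 + C₁) / (2 * M.σ0sq) + c₂ ^ 2 * C * (∫ x in Set.Ioi (0 : ℝ), x * M.pr x) / 2) :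
    evidenceFactor M n c₂ (C₁ * q) (h * q) ≤
      (M.σ0sq * ((2 * M.σ0sq) ^ (-M.a / 2 - 1) * Real.exp (-M.b / (2 * M.σ0sq)) *
        Real.exp (-(1 / 2))))⁻¹ * (n * Real.exp (D * h * q)) := by
  have hσ := M.hσ0
  set μ := ∫ x in Set.Ioi (0 : ℝ), x * M.pr x
  rw [evidenceFactor, div_eq_inv_mul, mul_assoc, mul_assoc, ← Real.exp_add]
  have hexp : (2 * (h * q) + C₁ * q) / (2 * M.σ0sq) + n * (c₂ ^ 2 * M.τsq n * μ / 2)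
      ≤ D * h * q := by
    have hqh : q ≤ h * q := by nlinarith
    have h1 : n * (c₂ ^ 2 * M.τsq n * μ / 2) ≤ c₂ ^ 2 * C * μ / 2 * (h * q) := by
      calc n * (c₂ ^ 2 * M.τsq n * μ / 2) = c₂ ^ 2 * μ / 2 * (n * M.τsq n) := by ring
        _ ≤ c₂ ^ 2 * μ / 2 * (C * (h * q)) := by
            have : C * q ≤ C * (h * q) := by gcongr
            exact mul_le_mul_of_nonneg_left (hτ.trans this) (by positivity)
        _ = _ := by ring
    have h2 : (2 * (h * q) + C₁ * q) / (2 * M.σ0sq) ≤ (2 + C₁) / (2 * M.σ0sq) * (h * q) := by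
      rw [div_mul_eq_mul_div]
      have : C₁ * q ≤ C₁ * (h * q) := by gcongr
      gcongr
      linarith
    rw [hD]
    linarith
  gcongr

set_option maxHeartbeats 2000000 in
/-- Explicit rate for the expected posterior probability of a large prediction error. -/
theorem abs_E0_postProb_le_rate {M : Model} {n : ℕ} (hM : Measurable M.pr) (hn : 0 < n)
    (hτ : 0 < M.τsq n) {c₁ c₂ : ℝ} (hc₁ : 0 < c₁) (hc₂ : 0 < c₂)
    (hlow : ∀ v, c₁ ^ 2 * sqnorm v ≤ sqnorm (M.K n *ᵥ v))
    (hup : ∀ v, sqnorm (M.K n *ᵥ v) ≤ c₂ ^ 2 * sqnorm v)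
    (hint : IntegrableOn M.pr (Set.Ioi 0))
    (hint1 : IntegrableOn (fun x => x * M.pr x) (Set.Ioi 0))
    (hint2 : IntegrableOn (fun x => x ^ 2 * M.pr x) (Set.Ioi 0)) {C C₁ q h m D F B g μ ν ℓ : ℝ}
    (hμ : μ = ∫ x in Set.Ioi (0 : ℝ), x * M.pr x)
    (hν : ν = ∫ x in Set.Ioi (0 : ℝ), x ^ 2 * M.pr x)
    (hℓ : ℓ = Real.log n) (hℓ1 : 4 ≤ ℓ) (hℓu : ℓ ^ 2 ≤ Real.exp (ℓ / 4))
    (hg : g = M.σ0sq * ((2 * M.σ0sq) ^ (-M.a / 2 - 1) * Real.exp (-M.b / (2 * M.σ0sq)) *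
        Real.exp (-(1 / 2))))
    (hC₁ : 0 < C₁) (hC : 0 < C) (hβ : sqnorm (M.K n *ᵥ M.β0 n) ≤ C₁ * q)
    (hq : 1 ≤ q) (hqn : q ≤ n) (hh : 8 ≤ h) (hhq : h * q ≤ n)
    (hτC : M.τsq n ≤ C * ((n : ℝ) ^ (-(3 : ℝ) / 2) * q)) (hm : h ^ 4 ≤ m) (hm' : 4 * C₁ ≤ m)
    (hD : D = (2 + C₁) / (2 * M.σ0sq) + c₂ ^ 2 * C * μ / 2)
    (hF : F = C ^ 2 * ν) (hDE : D + 2 * μ * C ≤ ℓ / 4) (hDF : D + F + 2 ≤ h * c₁ ^ 2 / 16)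
    (hB : B = 2 + D + c₂ ^ 2 * C₁ / c₁ ^ 2 + 4 * M.σ0sq * c₂ ^ 2 / c₁ ^ 2) :
    |M.E0 n fun Y => M.postProb n Y {β | m * q ≤ sqnorm (M.K n *ᵥ β - M.K n *ᵥ M.β0 n)}|
      ≤ (2 * Real.exp (-ℓ) + Real.exp (-(h / (2 * M.σ0sq * C₁)))) +
        (g⁻¹ * igMass M.a M.b * (Real.exp (-ℓ) + 2 * F * Real.exp (-(h * c₁ ^ 2 / 16))) +
        g⁻¹ * igMass M.a M.b * Real.exp (-n) +
        (16 * C₁ + 64 * M.σ0sq * c₂ ^ 2 + 64 * c₂ ^ 2 * Real.exp (2 * B)) * h⁻¹) := by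
  have hσ := M.hσ0
  have hn' : (0 : ℝ) < n := by exact_mod_cast hn
  have hμ0 : 0 ≤ μ := hμ ▸ setIntegral_nonneg measurableSet_Ioi fun x hx =>
    mul_nonneg (le_of_lt hx) (M.hpr_nonneg x)
  have hν0 : 0 ≤ ν := hν ▸ setIntegral_nonneg measurableSet_Ioi fun x _ =>
    mul_nonneg (sq_nonneg x) (M.hpr_nonneg x)
  have hℓ0 : 0 < ℓ := by linarith
  have hh0 : 0 < h := by linarith
  have hq0 : 0 < q := by linarith
  have hm0 : 0 < m := (pow_pos hh0 4).trans_le hm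
  have hexpℓ : Real.exp ℓ = n := by rw [hℓ, Real.exp_log hn']
  have hg0 : 0 < g := by
    have : 0 < (2 * M.σ0sq) ^ (-M.a / 2 - 1) := Real.rpow_pos_of_pos (by positivity) _
    rw [hg]; positivity
  have hG0 := igMass_nonneg M.a M.b
  set G := igMass M.a M.b
  have hF0 : 0 ≤ F := by rw [hF]; positivity
  have hD0 : 0 ≤ D := by rw [hD]; positivity
  set u := Real.exp (ℓ / 4) with hu
  have hu1 : 1 ≤ u := Real.one_le_exp (by positivity)
  have hu0 : 0 < u := by linarith
  have hnu : (n : ℝ) = u ^ 4 := by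
    rw [← hexpℓ, hu, ← Real.exp_nat_mul]
    congr 1; push_cast; ring
  have hτu : M.τsq n ≤ C * (q / u ^ 6) := by
    refine hτC.trans_eq ?_
    have : (n : ℝ) ^ (-(3 : ℝ) / 2) = (u ^ 6)⁻¹ := by
      rw [Real.rpow_def_of_pos hn', ← hℓ, hu, ← Real.exp_nat_mul, ← Real.exp_neg]
      congr 1; push_cast; ring
    rw [this, div_eq_inv_mul]
  have hnτ : n * M.τsq n ≤ C * q / u ^ 2 := by
    calc n * M.τsq n ≤ u ^ 4 * (C * (q / u ^ 6)) := by rw [hnu]; gcongr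
      _ = _ := by field_simp
  have hnτ' : n * M.τsq n ≤ C * q := hnτ.trans (div_le_self (by positivity) (one_le_pow₀ hu1))
  set w := n * (Real.exp (ℓ / 4) * (ℓ ^ 2) ^ 2 * M.τsq n ^ 2 * ν) with hw
  have hw0 : 0 ≤ w := by positivity
  have hwb : n * w ≤ F * q ^ 2 / u := by
    calc n * w ≤ u ^ 4 * (u ^ 4 * (u * u ^ 2 * (C * (q / u ^ 6)) ^ 2 * ν)) := by
          rw [hw, hnu]; gcongr
      _ = _ := by rw [hF]; field_simp
  have hNw : n * w ≤ F * q ^ 2 := hwb.trans (div_le_self (by positivity) hu1)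
  have hwF : w ≤ F * q := by
    refine le_of_mul_le_mul_left (hNw.trans ?_) hn'
    nlinarith [mul_nonneg hF0 hq0.le]
  have hx : 0 < h ^ 2 * q / ℓ := by positivity
  have hη : 2 ≤ Real.exp (ℓ / 4) := by
    have := Real.add_one_le_exp (ℓ / 4)
    linarith
  have ht := lintegral_prior_tail_le hM M.hpr_nonneg M.hpr_int hint hint1 hint2 (n := n)
    hτ hc₁ hx (θ := ℓ ^ 2) (by positivity) hη
  rw [← hμ, ← hν, ← hw] at ht
  have h4b : 4 * (C₁ * q) ≤ m * q := by
    rw [← mul_assoc]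
    gcongr
  set t₁ := Real.exp (n * (2 * ℓ ^ 2 * M.τsq n * μ) - ℓ ^ 2 * (h ^ 2 * q / ℓ) / 2) with ht₁
  set t₂ := 2 * Real.exp (-(ℓ / 4 * c₁ ^ 2 * (h ^ 2 * q / ℓ) / 2)) * (w * Real.exp w) with ht₂
  have ht₁0 : 0 ≤ t₁ := (Real.exp_pos _).le
  have ht₂0 : 0 ≤ t₂ := by positivity
  rw [← ENNReal.ofReal_add ht₁0 ht₂0] at ht
  have hmain := abs_E0_postProb_le hM hn hτ hc₁ hc₂ hlow hup hint hint1 (b := C₁ * q)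
    (L := 4 * M.σ0sq * c₂ ^ 2 * ℓ) (k := h * q) (x := h ^ 2 * q / ℓ)
    (S := Real.exp (2 * B) * ℓ) (H := m * q) (r := ℓ) (by positivity) hβ (by positivity)
    (by positivity) hx.le (mul_pos (Real.exp_pos _) hℓ0) hℓ0 (mul_pos hm0 hq0) h4b
    (add_nonneg ht₁0 ht₂0) ht
  refine hmain.trans ?_
  set A := evidenceFactor M n c₂ (C₁ * q) (h * q)
  have hA0 : 0 ≤ A := evidenceFactor_nonneg M n c₂ _ _
  have hA : A ≤ g⁻¹ * (n * Real.exp (D * h * q)) := by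
    rw [hg]
    exact evidenceFactor_le M n hC₁.le (hμ ▸ hμ0) hC.le hq0.le (by linarith) hnτ' (hμ ▸ hD)
  refine add_le_add (add_le_add ?_ ?_) (add_le_add (add_le_add ?_ ?_) ?_)
  · have h1 : 4 * M.σ0sq * c₂ ^ 2 * ℓ / (2 * M.σ0sq * c₂ ^ 2) = 2 * ℓ := by field_simp; norm_num
    rw [h1, ← hexpℓ, mul_assoc, ← Real.exp_add]
    refine le_of_eq ?_
    congr 2; ring
  · refine Real.exp_le_exp.2 (neg_le_neg ?_)
    rw [div_le_div_iff₀ (by positivity) (by positivity)]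
    have h1 : h ≤ h ^ 2 * q := by nlinarith [mul_nonneg hh0.le hq0.le]
    have h2 : 0 < 2 * M.σ0sq * C₁ * q := by positivity
    calc h * (2 * M.σ0sq * (C₁ * q)) = h * (2 * M.σ0sq * C₁ * q) := by ring
      _ ≤ h ^ 2 * q * (2 * M.σ0sq * C₁ * q) := by gcongr
      _ = _ := by ring
  · have hlin := exp_rate_linear (e := n * (2 * ℓ ^ 2 * M.τsq n * μ)) hℓ0
      (by positivity : 0 ≤ 2 * μ * C) hD0 hh hq hDE (by
        calc n * (2 * ℓ ^ 2 * M.τsq n * μ) = 2 * μ * (n * M.τsq n) * ℓ ^ 2 := by ring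
          _ ≤ 2 * μ * (C * q / u ^ 2) * u ^ 2 := by
              have : ℓ ^ 2 ≤ u ^ 2 := hℓu.trans (le_self_pow₀ hu1 two_ne_zero)
              gcongr
          _ = _ := by field_simp)
    have hquad := exp_rate_quadratic hℓ0 hF0 (pow_pos hc₁ 2) (by linarith : 1 ≤ h) hq hDF
      hwF hNw
    rw [hexpℓ] at hlin
    calc A * (G * (t₁ + t₂)) ≤ g⁻¹ * (n * Real.exp (D * h * q)) * (G * (t₁ + t₂)) := by gcongr
      _ = g⁻¹ * G * (n * Real.exp (D * h * q) * t₁ + n * Real.exp (D * h * q) * t₂) := by ring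
      _ ≤ _ := by gcongr
  · have hrat : √ℓ / √(Real.exp (2 * B) * ℓ) = Real.exp (-B) := by
      rw [Real.sqrt_mul (Real.exp_pos _).le, ← Real.exp_half, Real.exp_neg,
        mul_div_cancel_left₀ B two_ne_zero]
      have := Real.sqrt_pos.2 hℓ0
      field_simp
    have hexp : (2 * (c₂ ^ 2 * (C₁ * q)) + 2 * (n * (4 * M.σ0sq * c₂ ^ 2 * ℓ))) / c₁ ^ 2 / (2 * ℓ)
        ≤ n * (c₂ ^ 2 * C₁ / c₁ ^ 2 + 4 * M.σ0sq * c₂ ^ 2 / c₁ ^ 2) := by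
      have h1 : (2 * (c₂ ^ 2 * (C₁ * q)) + 2 * (n * (4 * M.σ0sq * c₂ ^ 2 * ℓ))) / c₁ ^ 2 / (2 * ℓ)
          = (q / ℓ) * (c₂ ^ 2 * C₁ / c₁ ^ 2) + n * (4 * M.σ0sq * c₂ ^ 2 / c₁ ^ 2) := by
        field_simp
      have h2 : q / ℓ ≤ n := (div_le_self hq0.le (by linarith)).trans hqn
      rw [h1, mul_add]
      gcongr
    have hnexp : (n : ℝ) ≤ Real.exp n := by linarith [Real.add_one_le_exp (n : ℝ)]
    rw [hrat]
    calc _ ≤ g⁻¹ * (Real.exp n * Real.exp (D * n)) * (Real.exp (-B) ^ n *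
          Real.exp (n * (c₂ ^ 2 * C₁ / c₁ ^ 2 + 4 * M.σ0sq * c₂ ^ 2 / c₁ ^ 2))) * G := by
          have hDhq : D * h * q ≤ D * n := by rw [mul_assoc]; gcongr
          gcongr
          exact hA.trans (by gcongr)
      _ = g⁻¹ * G * Real.exp (n + D * n + (n * -B +
          n * (c₂ ^ 2 * C₁ / c₁ ^ 2 + 4 * M.σ0sq * c₂ ^ 2 / c₁ ^ 2))) := by
          rw [Real.exp_add, Real.exp_add, Real.exp_add (n * -B), Real.exp_nat_mul (-B) n]; ring
      _ = _ := by
          congr 2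
          rw [hB]; field_simp; ring
  · have h1 : (4 * (C₁ * q) + 4 * (4 * M.σ0sq * c₂ ^ 2 * ℓ * (h ^ 2 * q / ℓ)) +
        16 * (c₂ ^ 2 * (Real.exp (2 * B) * ℓ) * (h ^ 2 * q / ℓ))) / (m * q / 4)
        = (16 * C₁ + (64 * M.σ0sq * c₂ ^ 2 + 64 * c₂ ^ 2 * Real.exp (2 * B)) * h ^ 2) / m := by
      field_simp; ring
    have hh2 : 1 ≤ h ^ 2 := one_le_pow₀ (by linarith)
    have hm3 : h ^ 2 * h ≤ m := by
      refine le_trans ?_ hm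
      nlinarith [pow_pos hh0 3]
    rw [h1, div_le_iff₀ hm0]
    set Q := 64 * M.σ0sq * c₂ ^ 2 + 64 * c₂ ^ 2 * Real.exp (2 * B)
    have hQ : 0 ≤ Q := by positivity
    calc 16 * C₁ + Q * h ^ 2 ≤ 16 * C₁ * h ^ 2 + Q * h ^ 2 := by
          linarith [le_mul_of_one_le_right (by positivity : 0 ≤ 16 * C₁) hh2]
      _ = (16 * C₁ + Q) * h⁻¹ * (h ^ 2 * h) := by field_simp
      _ ≤ (16 * C₁ + Q) * h⁻¹ * m := by gcongr
      _ = _ := by ring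

/-- The model with its prior density replaced by another version. -/
def withPrior (M : Model) (f : ℝ → ℝ) (hf0 : ∀ x, 0 ≤ f x) (hfs : ∀ x ≤ 0, f x = 0)
    (hf : f =ᵐ[volume] M.pr) : Model :=
  { M with
    pr := f
    hpr_nonneg := hf0
    hpr_supp := hfs
    hpr_int := (integral_congr_ae (ae_restrict_of_ae hf)).trans M.hpr_int }

theorem ae_jd_withPrior {M : Model} {f : ℝ → ℝ} (hf0 : ∀ x, 0 ≤ f x) (hfs : ∀ x ≤ 0, f x = 0)
    (hf : f =ᵐ[volume] M.pr) (n : ℕ) (Y : Fin n → ℝ) :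
    ∀ᵐ p : (Fin n → ℝ) × ℝ × (Fin n → ℝ),
      (withPrior M f hf0 hfs hf).jd n Y p.1 p.2.1 p.2.2 = M.jd n Y p.1 p.2.1 p.2.2 := by
  have h1 : ∀ i, ∀ᵐ p : (Fin n → ℝ) × ℝ × (Fin n → ℝ), f (p.2.2 i) = M.pr (p.2.2 i) := by
    intro i
    have hq : Measure.QuasiMeasurePreserving
        (fun p : (Fin n → ℝ) × ℝ × (Fin n → ℝ) => p.2.2 i) volume volume :=
      (Measure.quasiMeasurePreserving_eval (fun _ : Fin n => (volume : Measure ℝ)) i).comp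
        (Measure.quasiMeasurePreserving_snd.comp Measure.quasiMeasurePreserving_snd)
    exact hq.ae hf
  filter_upwards [ae_all_iff.2 h1] with p hp
  simp [Model.jd, withPrior, hp]

theorem postProb_withPrior {M : Model} {f : ℝ → ℝ} (hf0 : ∀ x, 0 ≤ f x) (hfs : ∀ x ≤ 0, f x = 0)
    (hf : f =ᵐ[volume] M.pr) (n : ℕ) (Y : Fin n → ℝ) (E : Set (Fin n → ℝ)) :
    (withPrior M f hf0 hfs hf).postProb n Y E = M.postProb n Y E := by
  have h := ae_jd_withPrior hf0 hfs hf n Y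
  rw [Model.postProb, Model.postProb, Model.Z, Model.Z,
    integral_congr_ae (ae_restrict_of_ae h), integral_congr_ae (ae_restrict_of_ae h)]

theorem E0_postProb_withPrior {M : Model} {f : ℝ → ℝ} (hf0 : ∀ x, 0 ≤ f x)
    (hfs : ∀ x ≤ 0, f x = 0) (hf : f =ᵐ[volume] M.pr) (n : ℕ) (E : Set (Fin n → ℝ)) :
    (withPrior M f hf0 hfs hf).E0 n (fun Y => (withPrior M f hf0 hfs hf).postProb n Y E) =
      M.E0 n (fun Y => M.postProb n Y E) := by
  simp only [postProb_withPrior]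
  rfl

theorem integrableOn_prior (M : Model) : IntegrableOn M.pr (Set.Ioi 0) := by
  by_contra h
  have := M.hpr_int
  rw [integral_undef h] at this
  exact zero_ne_one this

/-- Every prior density agrees almost everywhere with a measurable one. -/
theorem exists_measurable_prior (M : Model) :
    ∃ f : ℝ → ℝ, Measurable f ∧ (∀ x, 0 ≤ f x) ∧ (∀ x ≤ 0, f x = 0) ∧ f =ᵐ[volume] M.pr := by
  have hm : AEMeasurable M.pr (volume.restrict (Set.Ioi 0)) :=
    (integrableOn_prior M).aestronglyMeasurable.aemeasurable
  refine ⟨(Set.Ioi 0).indicator fun x => max (hm.mk _ x) 0,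
    (hm.measurable_mk.max measurable_const).indicator measurableSet_Ioi,
    fun x => Set.indicator_nonneg (fun _ _ => le_max_right _ _) x,
    fun x hx => Set.indicator_of_notMem (by simpa using hx) _, ?_⟩
  have h := (ae_restrict_iff' measurableSet_Ioi).1 hm.ae_eq_mk
  filter_upwards [h] with x hx
  by_cases hx0 : x ∈ Set.Ioi (0 : ℝ)
  · rw [Set.indicator_of_mem hx0, ← hx hx0, max_eq_left (M.hpr_nonneg x)]
  · rw [Set.indicator_of_notMem hx0, M.hpr_supp x (by simpa using hx0)]

theorem moment4_withPrior {M : Model} {f : ℝ → ℝ} (hf0 : ∀ x, 0 ≤ f x) (hfs : ∀ x ≤ 0, f x = 0)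
    (hf : f =ᵐ[volume] M.pr) (h : M.Moment4) : (withPrior M f hf0 hfs hf).Moment4 := by
  refine Integrable.congr h (ae_restrict_of_ae ?_)
  filter_upwards [hf] with x hx
  simp [withPrior, hx]

theorem integrableOn_mul_prior {M : Model} (hM : Measurable M.pr) (h : M.Moment4) :
    IntegrableOn (fun x => x * M.pr x) (Set.Ioi 0) := by
  refine Integrable.mono' ((integrableOn_prior M).add h)
    (measurable_id.mul hM).aestronglyMeasurable (ae_of_all _ fun x => ?_)
  have h0 := M.hpr_nonneg x
  rw [Real.norm_eq_abs, abs_mul, abs_of_nonneg h0, Pi.add_apply]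
  have : |x| ≤ 1 + x ^ 2 := abs_le.2 ⟨by nlinarith [sq_nonneg (x+1)], by nlinarith [sq_nonneg (x-1)]⟩
  nlinarith

theorem card_support_le (M : Model) (n : ℕ) : M.q n ≤ n := by
  have := Set.ncard_le_card {i : Fin n | M.β0 n i ≠ 0}
  simpa [Model.q] using this

theorem sqnorm_β0_le {M : Model} {B : ℝ} {n : ℕ} (hB : ∀ i, |M.β0 n i| < B) :
    sqnorm (M.β0 n) ≤ B ^ 2 * M.q n := by
  classical
  rw [sqnorm_eq_sum, Model.q, Set.ncard_eq_toFinset_card']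
  calc ∑ i, (M.β0 n i) ^ 2 = ∑ i ∈ {i : Fin n | M.β0 n i ≠ 0}.toFinset, (M.β0 n i) ^ 2 := by
        refine (Finset.sum_subset (Finset.subset_univ _) fun i _ hi => ?_).symm
        have : M.β0 n i = 0 := by simpa using hi
        simp [this]
    _ ≤ ∑ i ∈ {i : Fin n | M.β0 n i ≠ 0}.toFinset, B ^ 2 := by
        refine Finset.sum_le_sum fun i _ => ?_
        exact sq_le_sq' (by linarith [(abs_lt.1 (hB i)).1]) (abs_lt.1 (hB i)).2.le
    _ = _ := by rw [Finset.sum_const, nsmul_eq_mul, mul_comm]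

/-- The conclusion of the theorem when the prior density is measurable. -/
theorem tendsto_E0_postProb_of_measurable {M : Model} (hM : Measurable M.pr)
    (hτpos : ∀ n, 0 < M.τsq n) (hA1 : M.CondA1) (hA2 : M.CondA2) (hA3 : M.CondA3)
    (hτ : ∃ C > (0 : ℝ), ∃ N : ℕ, ∀ n ≥ N,
      M.τsq n ≤ C * ((n : ℝ) ^ (-(3 : ℝ) / 2) * M.q n))
    (hmom : M.Moment4) {Mseq : ℕ → ℝ} (hMseq : Tendsto Mseq atTop atTop) :
    Tendsto
      (fun n => M.E0 n (fun Y => M.postProb n Y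
        {β | Mseq n * M.q n ≤ sqnorm (M.K n *ᵥ β - M.K n *ᵥ M.β0 n)}))
      atTop (nhds 0) := by
  obtain ⟨c₁, c₂, hc₁, hc₁₂, N, hK⟩ := hA1
  obtain ⟨B₀, hB₀⟩ := hA2
  obtain ⟨C, hC, N', hτC⟩ := hτ
  have hc₂ : 0 < c₂ := hc₁.trans_le hc₁₂
  have hσ := M.hσ0
  set C₁ := c₂ ^ 2 * (B₀ ^ 2 + 1) with hC₁
  have hC₁0 : 0 < C₁ := by positivity
  set μ := ∫ x in Set.Ioi (0 : ℝ), x * M.pr x with hμ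
  set ν := ∫ x in Set.Ioi (0 : ℝ), x ^ 2 * M.pr x with hν
  set g := M.σ0sq * ((2 * M.σ0sq) ^ (-M.a / 2 - 1) * Real.exp (-M.b / (2 * M.σ0sq)) *
    Real.exp (-(1 / 2))) with hg
  set D := (2 + C₁) / (2 * M.σ0sq) + c₂ ^ 2 * C * μ / 2 with hD
  set F := C ^ 2 * ν with hF
  set B := 2 + D + c₂ ^ 2 * C₁ / c₁ ^ 2 + 4 * M.σ0sq * c₂ ^ 2 / c₁ ^ 2 with hB
  set h : ℕ → ℝ := fun n => min (√√(Mseq n)) (n / M.q n) with hh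
  have hlog : Tendsto (fun n : ℕ => Real.log n) atTop atTop :=
    Real.tendsto_log_atTop.comp tendsto_natCast_atTop_atTop
  have hq1 : ∀ᶠ n in atTop, (1 : ℝ) ≤ M.q n := by
    filter_upwards [eventually_ge_atTop N'] with n hn
    have h1 := (hτpos n).trans_le (hτC n hn)
    rcases Nat.eq_zero_or_pos (M.q n) with h0 | h0
    · simp [h0] at h1
    · exact_mod_cast h0
  have hnq : Tendsto (fun n : ℕ => (n : ℝ) / M.q n) atTop atTop := by
    have h1 : Tendsto (fun n => (M.q n : ℝ) / n) atTop (nhdsWithin 0 (Set.Ioi 0)) := by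
      refine tendsto_nhdsWithin_iff.2 ⟨hA3, ?_⟩
      filter_upwards [hq1, eventually_gt_atTop 0] with n hn hn0
      have : (0 : ℝ) < n := by exact_mod_cast hn0
      exact div_pos (by linarith) this
    exact h1.inv_tendsto_nhdsGT_zero.congr fun n => inv_div _ _
  have hhtop : Tendsto h atTop atTop := by
    refine tendsto_atTop.2 fun r => ?_
    filter_upwards [(Real.tendsto_sqrt_atTop.comp
      (Real.tendsto_sqrt_atTop.comp hMseq)).eventually_ge_atTop r,
      hnq.eventually_ge_atTop r] with n h1 h2
    exact le_min h1 h2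
  have hhinv : Tendsto (fun n => (h n)⁻¹) atTop (nhds 0) := tendsto_inv_atTop_zero.comp hhtop
  have hexp : ∀ {u : ℕ → ℝ}, Tendsto u atTop atTop →
      Tendsto (fun n => Real.exp (-u n)) atTop (nhds 0) := fun hu =>
    Real.tendsto_exp_neg_atTop_nhds_zero.comp hu
  have hlim : Tendsto (fun n : ℕ =>
      (2 * Real.exp (-Real.log n) + Real.exp (-(h n / (2 * M.σ0sq * C₁)))) +
      (g⁻¹ * igMass M.a M.b * (Real.exp (-Real.log n) +
          2 * F * Real.exp (-(h n * c₁ ^ 2 / 16))) +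
        g⁻¹ * igMass M.a M.b * Real.exp (-(n : ℝ)) +
        (16 * C₁ + 64 * M.σ0sq * c₂ ^ 2 + 64 * c₂ ^ 2 * Real.exp (2 * B)) * (h n)⁻¹))
      atTop (nhds 0) := by
    have e1 := hexp hlog
    have e2 := hexp (hhtop.atTop_div_const (by positivity : 0 < 2 * M.σ0sq * C₁))
    have e3 := hexp ((hhtop.atTop_mul_const (by positivity : 0 < c₁ ^ 2)).atTop_div_const
      (by norm_num : (0 : ℝ) < 16))
    have e4 := hexp (tendsto_natCast_atTop_atTop (R := ℝ))
    have := ((e1.const_mul 2).add e2).add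
      ((((e1.add (e3.const_mul (2 * F))).const_mul (g⁻¹ * igMass M.a M.b)).add
        (e4.const_mul (g⁻¹ * igMass M.a M.b))).add
        (hhinv.const_mul
          (16 * C₁ + 64 * M.σ0sq * c₂ ^ 2 + 64 * c₂ ^ 2 * Real.exp (2 * B))))
    simpa only [mul_zero, add_zero] using this
  have hlogexp : ∀ᶠ n : ℕ in atTop,
      (Real.log n) ^ 2 ≤ Real.exp (Real.log n / 4) := by
    have h1 := ((Real.tendsto_exp_div_pow_atTop 2).comp
      (hlog.atTop_div_const (by norm_num : (0 : ℝ) < 4))).eventually_ge_atTop 16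
    filter_upwards [h1, hlog.eventually_ge_atTop 4] with n hn hn4
    have hn4' : (4 : ℝ) ≤ Real.log n := hn4
    rw [Function.comp_apply, le_div_iff₀ (by positivity)] at hn
    linarith [show 16 * (Real.log n / 4) ^ 2 = Real.log n ^ 2 by ring]
  refine squeeze_zero_norm' ?_ hlim
  filter_upwards [eventually_gt_atTop 0, eventually_ge_atTop N, eventually_ge_atTop N',
    hlog.eventually_ge_atTop 4, hlogexp, hq1, hhtop.eventually_ge_atTop 8,
    hMseq.eventually_ge_atTop (4 * C₁), hlog.eventually_ge_atTop (4 * (D + 2 * μ * C)),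
    hhtop.eventually_ge_atTop ((D + F + 2) * 16 / c₁ ^ 2)]
    with n hn0 hN hN' hℓ4 hℓu hq hh8 hm' hDE hDF
  obtain ⟨hK1, hK2⟩ := hK n hN
  have hup := sqnorm_mulVec_le (M.hK n).posSemidef hc₂ hK2
  have hn0' : (0 : ℝ) < n := by exact_mod_cast hn0
  have hm0 : 0 ≤ Mseq n := (by positivity : 0 ≤ 4 * C₁).trans hm'
  have hβ : sqnorm (M.K n *ᵥ M.β0 n) ≤ C₁ * M.q n := by
    calc _ ≤ c₂ ^ 2 * (B₀ ^ 2 * M.q n) := (hup _).trans (by gcongr; exact sqnorm_β0_le (hB₀ n))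
      _ ≤ c₂ ^ 2 * ((B₀ ^ 2 + 1) * M.q n) := by gcongr; linarith
      _ = _ := by rw [hC₁]; ring
  have hm4 : h n ^ 4 ≤ Mseq n := by
    calc h n ^ 4 ≤ (√√(Mseq n)) ^ 4 := by
          have h0 : 0 ≤ h n := by linarith
          exact pow_le_pow_left₀ h0 (min_le_left _ _) 4
      _ = Mseq n := by
          rw [show 4 = 2 * 2 from rfl, pow_mul, Real.sq_sqrt (Real.sqrt_nonneg _),
            Real.sq_sqrt hm0]
  have hhq : h n * M.q n ≤ n := (le_div_iff₀ (by linarith)).1 (min_le_right _ _)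
  rw [Real.norm_eq_abs]
  exact abs_E0_postProb_le_rate hM hn0 (hτpos n) hc₁ hc₂ (le_sqnorm_mulVec hc₁ hK1) hup
    (integrableOn_prior M) (integrableOn_mul_prior hM hmom) hmom hμ hν rfl hℓ4 hℓu hg hC₁0 hC hβ hq
    (by exact_mod_cast card_support_le M n) hh8 hhq (hτC n hN') hm4 hm' hD hF (by linarith)
    (by rw [div_le_iff₀ (by positivity)] at hDF; linarith) hB

/-- **Corollary 1.** Under (A1)–(A3), if `τₙ² ⪯ n^{−3/2} qₙ` and `∫ λ⁴ π(λ²) dλ² < ∞`, then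
for any sequence `Mₙ → ∞`,
`E₀ P(‖Kₙβₙ − Kₙβ₀ₙ‖² ≥ Mₙ qₙ | Yₙ) → 0` as `n → ∞`. -/
theorem corollary1 (M : RVM.Model) (hτpos : ∀ n, 0 < M.τsq n)
    (hA1 : M.CondA1) (hA2 : M.CondA2) (hA3 : M.CondA3)
    (hτ : ∃ C > (0 : ℝ), ∃ N : ℕ, ∀ n ≥ N,
      M.τsq n ≤ C * ((n : ℝ) ^ (-(3 : ℝ) / 2) * M.q n))
    (hmom : M.Moment4)
    (Mseq : ℕ → ℝ) (hMseq : Tendsto Mseq atTop atTop) :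
    Tendsto
      (fun n => M.E0 n (fun Y => M.postProb n Y
        {β | Mseq n * M.q n ≤ sqnorm (M.K n *ᵥ β - M.K n *ᵥ M.β0 n)}))
      atTop (nhds 0) := by
  obtain ⟨f, hfm, hf0, hfs, hf⟩ := exists_measurable_prior M
  refine (tendsto_E0_postProb_of_measurable (M := withPrior M f hf0 hfs hf) hfm hτpos hA1 hA2 hA3
    hτ (moment4_withPrior hf0 hfs hf hmom) hMseq).congr fun n => ?_
  exact E0_postProb_withPrior hf0 hfs hf n _
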